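/- arXiv:2009.06853 — 4 statements merged into one kernel-verified Lean document; each statement's English description precedes it below -/
import Mathlib

section
/- The linear map ψ: 𝒯 → 𝔖 defined on basis elements by ψ(L_m) = (1/2)L_{2m}, ψ(I_m) = I_{2m}, ψ(G_{m+1/2}) = G_{2m+1} for m ∈ ℤ is an injective homomorphism of Lie superalgebras; consequently the super Heisenberg-Virasoro algebra of Neveu-Schwarz type 𝒯 is isomorphic to the subalgebra of 𝔖 spanned by {L_{2m}, I_{2m}, G_{2m+1} : m ∈ ℤ}. -/
/-- Basis of the super Heisenberg-Virasoro algebra of Ramond type 𝔖: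
`l m = L_m`, `i m = I_m`, `g m = G_m`. -/
inductive SB : Type
  | l : ℤ → SB
  | i : ℤ → SB
  | g : ℤ → SB
  deriving DecidableEq

/-- The underlying space of 𝔖: formal finite ℂ-linear combinations of basis elements. -/
abbrev SHV : Type := SB →₀ ℂ

/-- Parity: `L_m, I_m` are even, `G_m` is odd. -/
def par : SB → ZMod 2
  | .g _ => 1
  | _ => 0

/-- The bracket of 𝔖 on basis elements:
`[L_m, L_n] = (n-m)L_{m+n}`, `[L_m, I_n] = n I_{m+n}`, `[L_m, G_n] = n G_{m+n}`,
`[G_m, G_n] = 2 I_{m+n}`, all other brackets of basis elements vanish. -/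
noncomputable def sb : SB → SB → SHV
  | .l m, .l n => ((n : ℂ) - (m : ℂ)) • Finsupp.single (.l (m + n)) 1
  | .l m, .i n => (n : ℂ) • Finsupp.single (.i (m + n)) 1
  | .i m, .l n => (-(m : ℂ)) • Finsupp.single (.i (m + n)) 1
  | .l m, .g n => (n : ℂ) • Finsupp.single (.g (m + n)) 1
  | .g m, .l n => (-(m : ℂ)) • Finsupp.single (.g (m + n)) 1
  | .g m, .g n => (2 : ℂ) • Finsupp.single (.i (m + n)) 1
  | _, _ => 0

/-- The bracket of 𝔖, extended bilinearly to the whole space. -/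
noncomputable def br (x y : SHV) : SHV :=
  x.sum fun a ca => y.sum fun b cb => (ca * cb) • sb a b

/-- The sign `(-1)^{|a||b|}`. -/
noncomputable def sgn (a b : SB) : ℂ := if par a = 1 ∧ par b = 1 then -1 else 1

/-- A ℤ₂-graded representation of the subalgebra of 𝔖 spanned by the set `Q` of basis
elements (for `Q = Set.univ` this is a module over 𝔖 itself): a ℤ₂-graded complex vector
space with a parity-respecting action of the basis elements of `Q` satisfying the
super-commutation relations dictated by the bracket `sb`. -/
structure GRep (Q : Set SB) : Type 1 where
  V : Type
  [acg : AddCommGroup V]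
  [mod : Module ℂ V]
  act : SB → V →ₗ[ℂ] V
  grade : ZMod 2 → Submodule ℂ V
  grade_sup : ∀ v : V, ∃ v0 ∈ grade 0, ∃ v1 ∈ grade 1, v = v0 + v1
  grade_inf : grade 0 ⊓ grade 1 = ⊥
  act_grade : ∀ a ∈ Q, ∀ p : ZMod 2, ∀ v ∈ grade p, act a v ∈ grade (par a + p)
  act_br : ∀ a ∈ Q, ∀ b ∈ Q, ∀ v : V,
    act a (act b v) - sgn a b • act b (act a v) = (sb a b).sum fun c cc => cc • act c v

attribute [instance] GRep.acg GRep.mod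

/-- A (graded) submodule of a graded representation: a subspace stable under the action
and generated by its homogeneous components. -/
def IsSub {Q : Set SB} (ρ : GRep Q) (U : Submodule ℂ ρ.V) : Prop :=
  (∀ a ∈ Q, ∀ v ∈ U, ρ.act a v ∈ U) ∧
  ∀ v ∈ U, ∃ v0, v0 ∈ U ∧ v0 ∈ ρ.grade 0 ∧ ∃ v1, v1 ∈ U ∧ v1 ∈ ρ.grade 1 ∧ v = v0 + v1

/-- Simplicity: nonzero, and the only graded submodules are `⊥` and `⊤`. -/
def IsSimple {Q : Set SB} (ρ : GRep Q) : Prop :=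
  (∃ v : ρ.V, v ≠ 0) ∧ ∀ U : Submodule ℂ ρ.V, IsSub ρ U → U = ⊥ ∨ U = ⊤

/-- A linear map between graded representations which is even and `Q`-equivariant. -/
def SEquivMap (Q : Set SB) {Q1 Q2 : Set SB} (ρ : GRep Q1) (σ : GRep Q2)
    (f : ρ.V →ₗ[ℂ] σ.V) : Prop :=
  (∀ a ∈ Q, ∀ v : ρ.V, f (ρ.act a v) = σ.act a (f v)) ∧
  ∀ p : ZMod 2, ∀ v ∈ ρ.grade p, f v ∈ σ.grade p

/-- `(M, ι)` is the representation induced from the `Q`-representation `ρ` to the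
subalgebra spanned by `Q'` (i.e. `M = U(𝔤_{Q'}) ⊗_{U(𝔤_Q)} ρ`), characterized by its
universal property. -/
def IsInduced (Q : Set SB) {Q' : Set SB} (ρ : GRep Q) (M : GRep Q')
    (ι : ρ.V →ₗ[ℂ] M.V) : Prop :=
  SEquivMap Q ρ M ι ∧
  ∀ (N : GRep Q') (f : ρ.V →ₗ[ℂ] N.V), SEquivMap Q ρ N f →
    ∃! F : M.V →ₗ[ℂ] N.V, SEquivMap Q' M N F ∧ F ∘ₗ ι = f

/-- Basis of the subalgebra 𝔖_{α,β} = span{L_i, I_{i-α}, G_{i-β} : i ≥ 0}. -/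
def QS (α β : ℕ) : Set SB := fun x =>
  match x with
  | .l m => 0 ≤ m
  | .i m => -(α : ℤ) ≤ m
  | .g m => -(β : ℤ) ≤ m

/-- Basis of the subalgebra 𝔖^{(r,s,t)} = span{L_i : i ≥ r} ∪ {I_i : i ≥ s} ∪ {G_i : i ≥ t}. -/
def Qrst (r s t : ℕ) : Set SB := fun x =>
  match x with
  | .l m => (r : ℤ) ≤ m
  | .i m => (s : ℤ) ≤ m
  | .g m => (t : ℤ) ≤ m

/-- Basis of T(r) = 𝔖^{(r,r,r)}. -/
def T (r : ℕ) : Set SB := Qrst r r r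

/-- A restricted 𝔖-module. -/
def IsRestricted (ρ : GRep (Set.univ : Set SB)) : Prop :=
  ∀ w : ρ.V, ∃ k : ℕ, ∀ i : ℤ, (k : ℤ) < i →
    ρ.act (.l i) w = 0 ∧ ρ.act (.g i) w = 0 ∧ ρ.act (.i i) w = 0

/-- Local nilpotency of the action of a single operator. -/
def LocNil {W : Type} [AddCommGroup W] [Module ℂ W] (f : W →ₗ[ℂ] W) : Prop :=
  ∀ v : W, ∃ n : ℕ, (f ^ n) v = 0

/-- Local finiteness of the action of a single operator. -/
def LocFin {W : Type} [AddCommGroup W] [Module ℂ W] (f : W →ₗ[ℂ] W) : Prop :=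
  ∀ v : W, FiniteDimensional ℂ (Submodule.span ℂ (Set.range fun n : ℕ => (f ^ n) v))

/-- Basis of the super Heisenberg-Virasoro algebra of Neveu-Schwarz type 𝒯:
`l m = L_m`, `i m = I_m` (m ∈ ℤ), and `g m = G_{m + 1/2}` (so `g` indexes the
half-integers `r = m + 1/2`, m ∈ ℤ). -/
inductive TB : Type
  | l : ℤ → TB
  | i : ℤ → TB
  | g : ℤ → TB
  deriving DecidableEq

/-- The underlying space of 𝒯. -/
abbrev NS : Type := TB →₀ ℂ

/-- The bracket of 𝒯 on basis elements: `[L_m, L_n] = (n-m)L_{m+n}`,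
`[L_m, I_n] = n I_{m+n}`, `[L_m, G_r] = r G_{m+r}`, `[G_r, G_s] = 2 I_{r+s}`
(for half-integers `r = m + 1/2`, `s = n + 1/2`), all other brackets vanishing. -/
noncomputable def tb : TB → TB → NS
  | .l m, .l n => ((n : ℂ) - (m : ℂ)) • Finsupp.single (.l (m + n)) 1
  | .l m, .i n => (n : ℂ) • Finsupp.single (.i (m + n)) 1
  | .i m, .l n => (-(m : ℂ)) • Finsupp.single (.i (m + n)) 1
  | .l m, .g n => ((n : ℂ) + 2⁻¹) • Finsupp.single (.g (m + n)) 1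
  | .g m, .l n => (-((m : ℂ) + 2⁻¹)) • Finsupp.single (.g (m + n)) 1
  | .g m, .g n => (2 : ℂ) • Finsupp.single (.i (m + n + 1)) 1
  | _, _ => 0

/-- The bracket of 𝒯, extended bilinearly. -/
noncomputable def brT (x y : NS) : NS :=
  x.sum fun a ca => y.sum fun b cb => (ca * cb) • tb a b

/-- The linear map ψ : 𝒯 → 𝔖 with ψ(L_m) = (1/2)L_{2m}, ψ(I_m) = I_{2m},
ψ(G_{m+1/2}) = G_{2m+1}. -/
noncomputable def ψmap : NS →ₗ[ℂ] SHV :=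
  Finsupp.linearCombination ℂ fun a : TB =>
    match a with
    | .l m => (2⁻¹ : ℂ) • Finsupp.single (SB.l (2 * m)) 1
    | .i m => Finsupp.single (SB.i (2 * m)) 1
    | .g m => Finsupp.single (SB.g (2 * m + 1)) 1

/-- The bilinear extension of a map defined on pairs of basis elements. -/
noncomputable def bilinearExtension {α M : Type*} [AddCommGroup M] [Module ℂ M]
    (f : α → α → M) : (α →₀ ℂ) →ₗ[ℂ] (α →₀ ℂ) →ₗ[ℂ] M :=
  Finsupp.linearCombination ℂ fun a => Finsupp.linearCombination ℂ (f a)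

theorem bilinearExtension_apply {α M : Type*} [AddCommGroup M] [Module ℂ M]
    (f : α → α → M) (x y : α →₀ ℂ) :
    bilinearExtension f x y = x.sum fun a ca => y.sum fun b cb => (ca * cb) • f a b := by
  simp [bilinearExtension, Finsupp.linearCombination_apply, Finsupp.sum, Finset.smul_sum,
    LinearMap.sum_apply, mul_smul]

@[simp]
theorem bilinearExtension_single {α M : Type*} [AddCommGroup M] [Module ℂ M]
    (f : α → α → M) (a b : α) :
    bilinearExtension f (Finsupp.single a 1) (Finsupp.single b 1) = f a b := by
  simp [bilinearExtension]

@[simp]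
theorem ψmap_single_l (m : ℤ) :
    ψmap (Finsupp.single (.l m) 1) = (2⁻¹ : ℂ) • Finsupp.single (SB.l (2 * m)) 1 := by
  simp [ψmap]

@[simp]
theorem ψmap_single_i (m : ℤ) :
    ψmap (Finsupp.single (.i m) 1) = Finsupp.single (SB.i (2 * m)) 1 := by
  simp [ψmap]

@[simp]
theorem ψmap_single_g (m : ℤ) :
    ψmap (Finsupp.single (.g m) 1) = Finsupp.single (SB.g (2 * m + 1)) 1 := by
  simp [ψmap]

theorem ψmap_tb (a b : TB) :
    ψmap (tb a b) =
      bilinearExtension sb (ψmap (Finsupp.single a 1)) (ψmap (Finsupp.single b 1)) := by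
  rcases a with m | m | m <;> rcases b with n | n | n <;>
    simp only [tb, sb, map_smul, map_zero, LinearMap.smul_apply, ψmap_single_l, ψmap_single_i,
      ψmap_single_g, bilinearExtension_single, smul_smul] <;>
    refine congrArg₂ (· • ·) ?_ (congrArg (Finsupp.single · 1) ?_)
  all_goals first
    | push_cast; ring1
    | congr 1; ring1

theorem ψmap_brT (x y : NS) : ψmap (brT x y) = br (ψmap x) (ψmap y) := by
  have h : (bilinearExtension tb).compr₂ ψmap =
      (bilinearExtension sb).compl₁₂ ψmap ψmap := by
    ext a b : 4
    simpa using ψmap_tb a b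
  simpa [bilinearExtension_apply, brT, br] using LinearMap.congr_fun₂ h x y

/-- A linear left inverse of `ψmap`, halving the indices. -/
noncomputable def ψmapLeftInverse : SHV →ₗ[ℂ] NS :=
  Finsupp.linearCombination ℂ fun a : SB =>
    match a with
    | .l m => (2 : ℂ) • Finsupp.single (TB.l (m / 2)) 1
    | .i m => Finsupp.single (TB.i (m / 2)) 1
    | .g m => Finsupp.single (TB.g (m / 2)) 1

theorem ψmapLeftInverse_comp_ψmap : ψmapLeftInverse ∘ₗ ψmap = LinearMap.id := by
  refine Finsupp.lhom_ext' fun a => LinearMap.ext_ring ?_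
  rcases a with m | m | m
  · simp [ψmapLeftInverse]
  · simp [ψmapLeftInverse]
  · simp [ψmapLeftInverse, show (2 * m + 1) / 2 = m by omega]

theorem ψmap_injective : Function.Injective ψmap :=
  Function.LeftInverse.injective (g := ψmapLeftInverse)
    (LinearMap.congr_fun ψmapLeftInverse_comp_ψmap)

theorem range_ψmap :
    LinearMap.range ψmap =
      Submodule.span ℂ {x : SHV | ∃ m : ℤ,
        x = Finsupp.single (SB.l (2 * m)) 1 ∨
        x = Finsupp.single (SB.i (2 * m)) 1 ∨
        x = Finsupp.single (SB.g (2 * m + 1)) 1} := by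
  apply le_antisymm
  · rw [ψmap, Finsupp.range_linearCombination, Submodule.span_le]
    rintro _ ⟨m | m | m, rfl⟩
    · exact Submodule.smul_mem _ _ (Submodule.subset_span ⟨m, .inl rfl⟩)
    · exact Submodule.subset_span ⟨m, .inr (.inl rfl)⟩
    · exact Submodule.subset_span ⟨m, .inr (.inr rfl)⟩
  · rw [Submodule.span_le]
    rintro _ ⟨m, rfl | rfl | rfl⟩
    · exact ⟨(2 : ℂ) • Finsupp.single (TB.l m) 1, by rw [map_smul, ψmap_single_l]; simp⟩
    · exact ⟨Finsupp.single (TB.i m) 1, ψmap_single_i m⟩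
    · exact ⟨Finsupp.single (TB.g m) 1, ψmap_single_g m⟩

/-- The map ψ is an injective homomorphism of Lie superalgebras
from 𝒯 to 𝔖, whose image is the subalgebra of 𝔖 spanned by
{L_{2m}, I_{2m}, G_{2m+1} : m ∈ ℤ}; hence 𝒯 is isomorphic to this subalgebra of 𝔖. -/
theorem NS_embeds_in_Ramond :
    Function.Injective ψmap ∧
    (∀ x y : NS, ψmap (brT x y) = br (ψmap x) (ψmap y)) ∧
    LinearMap.range ψmap =
      Submodule.span ℂ {x : SHV | ∃ m : ℤ,
        x = Finsupp.single (SB.l (2 * m)) 1 ∨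
        x = Finsupp.single (SB.i (2 * m)) 1 ∨
        x = Finsupp.single (SB.g (2 * m + 1)) 1} := by
  exact ⟨ψmap_injective, ψmap_brT, range_ψmap⟩
end

section
/- The center of the super Heisenberg-Virasoro algebra of Ramond type 𝔖 equals ℂI_0. -/
theorem br_single_right (x : SHV) (b : SB) :
    br x (Finsupp.single b 1) = x.sum fun a c => c • sb a b := by
  simp [br]

/-- A coefficient of `[x, b]` which receives a contribution from one basis element only. -/
theorem br_single_right_apply_of_unique (x : SHV) (a b c : SB)
    (h : ∀ a', a' ≠ a → sb a' b c = 0) :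
    br x (Finsupp.single b 1) c = x a * sb a b c := by
  rw [br_single_right, Finsupp.sum_apply, Finsupp.sum]
  refine (Finset.sum_eq_single a ?_ ?_).trans ?_
  · intro a' _ ha'
    simp [h a' ha']
  · intro ha
    simp [Finsupp.notMem_support_iff.mp ha]
  · simp

theorem sb_i_zero_left (b : SB) : sb (.i 0) b = 0 := by
  cases b <;> simp [sb]

theorem coeff_eq_zero_of_central {x : SHV} (hx : ∀ y, br x y = 0) {a b c : SB}
    (h : ∀ a', a' ≠ a → sb a' b c = 0) (hne : sb a b c ≠ 0) : x a = 0 := by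
  have key := br_single_right_apply_of_unique x a b c h
  rw [hx, Finsupp.zero_apply] at key
  exact (mul_eq_zero.mp key.symm).resolve_right hne

theorem coeff_l_eq_zero_of_central {x : SHV} (hx : ∀ y, br x y = 0) (m : ℤ) :
    x (.l m) = 0 := by
  refine coeff_eq_zero_of_central hx (b := .l (m + 1)) (c := .l (m + (m + 1))) ?_ ?_
  · rintro (n | n | n) hn <;> simp_all [sb]
  · simp [sb]

theorem coeff_g_eq_zero_of_central {x : SHV} (hx : ∀ y, br x y = 0) (m : ℤ) :
    x (.g m) = 0 := by
  refine coeff_eq_zero_of_central hx (b := .g 0) (c := .i m) ?_ ?_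
  · rintro (n | n | n) hn <;> simp_all [sb]
  · simp [sb]

theorem coeff_i_eq_zero_of_central {x : SHV} (hx : ∀ y, br x y = 0) {m : ℤ} (hm : m ≠ 0) :
    x (.i m) = 0 := by
  refine coeff_eq_zero_of_central hx (b := .l 0) (c := .i m) ?_ ?_
  · rintro (n | n | n) hn <;> simp_all [sb]
  · simp [sb, hm]

/-- The center of the super Heisenberg-Virasoro algebra of Ramond
type 𝔖 equals ℂ I₀. -/
theorem center_eq_CI0 :
    {x : SHV | ∀ y : SHV, br x y = 0} =
      (Submodule.span ℂ {Finsupp.single (SB.i 0) (1 : ℂ)} : Submodule ℂ SHV) := by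
  ext x
  rw [Set.mem_ofPred_eq, SetLike.mem_coe, Submodule.mem_span_singleton]
  constructor
  · intro hx
    refine ⟨x (.i 0), ?_⟩
    ext a
    rcases a with m | m | m
    · simp [coeff_l_eq_zero_of_central hx]
    · by_cases hm : m = 0
      · simp [hm]
      · simp [coeff_i_eq_zero_of_central hx hm, Ne.symm hm]
    · simp [coeff_g_eq_zero_of_central hx]
  · rintro ⟨c, rfl⟩ y
    simp [br, sb_i_zero_left]
end

section
/- Let α, β ∈ ℤ≥0 with α ≥ 2β and let V be a simple 𝔖_{α,β}-module. Assume there exists z ∈ ℤ≥0 such that (a) I_z acts injectively on V, and (b) L_i V = 0 for all i > z+α, G_j V = 0 for all j > z+β, and I_k V = 0 for all k > z. Then the induced module Ind(V) = U(𝔖) ⊗_{U(𝔖_{α,β})} V is a simple 𝔖-module. -/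
namespace SHVInd

/-! ### Structure constants -/

/-- The index of the basis vector to which `[a, b]` is proportional. -/
def star : SB → SB → SB
  | .l m, .l n => .l (m + n)
  | .l m, .i n => .i (m + n)
  | .l m, .g n => .g (m + n)
  | .i m, .l n => .i (m + n)
  | .i m, .i n => .i (m + n)
  | .i m, .g n => .g (m + n)
  | .g m, .l n => .g (m + n)
  | .g m, .i n => .g (m + n)
  | .g m, .g n => .i (m + n)

/-- The structure constants: `[a, b] = coef a b • (star a b)`. -/
noncomputable def coef : SB → SB → ℂ
  | .l m, .l n => (n : ℂ) - (m : ℂ)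
  | .l _, .i n => (n : ℂ)
  | .i m, .l _ => -(m : ℂ)
  | .l _, .g n => (n : ℂ)
  | .g m, .l _ => -(m : ℂ)
  | .g _, .g _ => 2
  | _, _ => 0

lemma sb_eq (a b : SB) : sb a b = coef a b • Finsupp.single (star a b) 1 := by
  cases a <;> cases b <;> simp [sb, coef, star]

lemma star_comm (a b : SB) : star a b = star b a := by
  cases a <;> cases b <;> simp [star, add_comm]

lemma star_assoc (a b c : SB) : star (star a b) c = star a (star b c) := by
  cases a <;> cases b <;> cases c <;> simp [star, add_assoc]

lemma star_left_comm (a b c : SB) : star b (star a c) = star a (star b c) := by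
  rw [← star_assoc, star_comm b a, star_assoc]

lemma par_star (a b : SB) : par (star a b) = par a + par b := by
  cases a <;> cases b <;> simp [star, par]; decide

lemma sgn_star_right (a b c : SB) : sgn a (star b c) = sgn a b * sgn a c := by
  cases a <;> cases b <;> cases c <;> simp [star, sgn, par]

lemma sgn_star_left (a b c : SB) : sgn (star a b) c = sgn a c * sgn b c := by
  cases a <;> cases b <;> cases c <;> simp [star, sgn, par]

lemma sgn_comm (a b : SB) : sgn a b = sgn b a := by
  simp only [sgn, and_comm]

lemma sgn_mul_self (a b : SB) : sgn a b * sgn a b = 1 := by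
  unfold sgn; split_ifs <;> norm_num

lemma coef_skew (a b : SB) : coef b a = -(sgn a b * coef a b) := by
  cases a <;> cases b <;> simp [sgn, par, coef]

lemma jacobi (a b c : SB) :
    coef b c * coef a (star b c) =
      coef a b * coef (star a b) c + sgn a b * (coef a c * coef b (star a c)) := by
  cases a <;> cases b <;> cases c <;> simp [sgn, par, coef, star] <;> ring

lemma act_act {Q : Set SB} (ρ : GRep Q) {a b : SB} (ha : a ∈ Q) (hb : b ∈ Q) (v : ρ.V) :
    ρ.act a (ρ.act b v) =
      sgn a b • ρ.act b (ρ.act a v) + coef a b • ρ.act (star a b) v := by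
  have h := ρ.act_br a ha b hb v
  rw [sb_eq, Finsupp.smul_single, Finsupp.sum_single_index (by simp)] at h
  rw [sub_eq_iff_eq_add'] at h
  simpa using h

lemma l_mem_QS {α β : ℕ} {m : ℤ} : SB.l m ∈ QS α β ↔ 0 ≤ m := Iff.rfl

lemma i_mem_QS {α β : ℕ} {m : ℤ} : SB.i m ∈ QS α β ↔ -(α : ℤ) ≤ m := Iff.rfl

lemma g_mem_QS {α β : ℕ} {m : ℤ} : SB.g m ∈ QS α β ↔ -(β : ℤ) ≤ m := Iff.rfl

lemma QS_closed {α β : ℕ} (h : 2 * β ≤ α) {a b : SB} (ha : a ∈ QS α β) (hb : b ∈ QS α β)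
    (hc : coef a b ≠ 0) : star a b ∈ QS α β := by
  rcases a with m | m | m <;> rcases b with n | n | n <;>
    simp_all [l_mem_QS, i_mem_QS, g_mem_QS, star, coef] <;> omega

/-! ### Subspaces generated under a family of operators -/

section gen

variable {A W : Type*} [AddCommGroup W] [Module ℂ W]

/-- The smallest subspace containing `W₀` and stable under the operators `f a`, `a ∈ S`. -/
def gen (f : A → W →ₗ[ℂ] W) (S : Set A) (W₀ : Set W) : Submodule ℂ W :=
  sInf {P | W₀ ⊆ P ∧ ∀ a ∈ S, ∀ x ∈ P, f a x ∈ P}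

variable {f : A → W →ₗ[ℂ] W} {S : Set A} {W₀ : Set W}

lemma subset_gen {x : W} (hx : x ∈ W₀) : x ∈ gen f S W₀ := by
  simp only [gen, Submodule.mem_sInf]
  exact fun P hP => hP.1 hx

lemma act_mem_gen {a : A} (ha : a ∈ S) {x : W} (hx : x ∈ gen f S W₀) :
    f a x ∈ gen f S W₀ := by
  simp only [gen, Submodule.mem_sInf] at hx ⊢
  exact fun P hP => hP.2 a ha x (hx P hP)

lemma gen_le {P : Submodule ℂ W} (h₀ : ∀ x ∈ W₀, x ∈ P)
    (h : ∀ a ∈ S, ∀ x ∈ gen f S W₀, x ∈ P → f a x ∈ P) : gen f S W₀ ≤ P := by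
  have : gen f S W₀ ≤ P ⊓ gen f S W₀ :=
    sInf_le ⟨fun x hx => ⟨h₀ x hx, subset_gen hx⟩,
      fun a ha x hx => ⟨h a ha x hx.2 hx.1, act_mem_gen ha hx.2⟩⟩
  exact this.trans inf_le_left

lemma gen_mono {S' : Set A} (h : S ⊆ S') : gen f S W₀ ≤ gen f S' W₀ :=
  gen_le (fun _ hx => subset_gen hx) fun _ ha _ _ hx => act_mem_gen (h ha) hx

lemma mem_gen_iUnion {T : ℕ → Set A} (hT : Monotone T) (hS : ∀ a ∈ S, ∃ n, a ∈ T n)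
    {x : W} (hx : x ∈ gen f S W₀) : ∃ n, x ∈ gen f (T n) W₀ := by
  have hmono : Monotone fun n => gen f (T n) W₀ := fun _ _ h => gen_mono (hT h)
  have : gen f S W₀ ≤ ⨆ n, gen f (T n) W₀ := by
    refine gen_le (fun x hx => Submodule.mem_iSup_of_mem 0 (subset_gen hx)) ?_
    intro a ha x _ hx
    obtain ⟨n, hn⟩ := (Submodule.mem_iSup_of_directed _ hmono.directed_le).1 hx
    obtain ⟨m, hm⟩ := hS a ha
    exact Submodule.mem_iSup_of_mem (max n m)
      (act_mem_gen (hT (le_max_right n m) hm) (hmono (le_max_left n m) hn))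
  exact (Submodule.mem_iSup_of_directed _ hmono.directed_le).1 (this hx)

/-- A subspace is graded if it is the sum of its homogeneous parts. -/
def IsGraded (g : ZMod 2 → Submodule ℂ W) (R : Submodule ℂ W) : Prop :=
  R ≤ (R ⊓ g 0) ⊔ (R ⊓ g 1)

lemma inf_grade_le (g : ZMod 2 → Submodule ℂ W) (R : Submodule ℂ W) (p : ZMod 2) :
    R ⊓ g p ≤ (R ⊓ g 0) ⊔ (R ⊓ g 1) := by
  fin_cases p
  · exact le_sup_left
  · exact le_sup_right

lemma isGraded_gen {g : ZMod 2 → Submodule ℂ W}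
    (h₀ : ∀ x ∈ W₀, x ∈ (gen f S W₀ ⊓ g 0) ⊔ (gen f S W₀ ⊓ g 1))
    (h : ∀ a ∈ S, ∀ p, ∃ q, ∀ x ∈ g p, f a x ∈ g q) : IsGraded g (gen f S W₀) := by
  refine gen_le h₀ fun a ha x _ hx => ?_
  obtain ⟨y, hy, y', hy', rfl⟩ := Submodule.mem_sup.1 hx
  obtain ⟨q, hq⟩ := h a ha 0
  obtain ⟨q', hq'⟩ := h a ha 1
  rw [map_add]
  exact add_mem (inf_grade_le _ _ q ⟨act_mem_gen ha hy.1, hq y hy.2⟩)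
    (inf_grade_le _ _ q' ⟨act_mem_gen ha hy'.1, hq' y' hy'.2⟩)

end gen

/-! ### Quotient representations -/

/-- The representation of 𝔖 on `W ⧸ R`, where `R` is a stable graded subspace containing all
the defects of the commutation relations. -/
noncomputable def quotRep {W : Type} [AddCommGroup W] [Module ℂ W] (act : SB → W →ₗ[ℂ] W)
    (grade : ZMod 2 → Submodule ℂ W)
    (hsup : ∀ v, ∃ v0 ∈ grade 0, ∃ v1 ∈ grade 1, v = v0 + v1) (hinf : grade 0 ⊓ grade 1 = ⊥)
    (hact : ∀ a p, ∀ v ∈ grade p, act a v ∈ grade (par a + p))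
    (R : Submodule ℂ W) (hR : ∀ a, ∀ x ∈ R, act a x ∈ R) (hgr : IsGraded grade R)
    (hrel : ∀ a b x,
      act a (act b x) - sgn a b • act b (act a x) - coef a b • act (star a b) x ∈ R) :
    GRep (Set.univ : Set SB) where
  V := W ⧸ R
  act a := R.mapQ R (act a) (hR a)
  grade p := (grade p).map R.mkQ
  grade_sup v := by
    obtain ⟨w, rfl⟩ := R.mkQ_surjective v
    obtain ⟨v0, h0, v1, h1, rfl⟩ := hsup w
    exact ⟨_, Submodule.mem_map_of_mem h0, _, Submodule.mem_map_of_mem h1, map_add _ _ _⟩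
  grade_inf := by
    rw [eq_bot_iff]
    rintro _ ⟨⟨x, hx, rfl⟩, ⟨y, hy, hxy⟩⟩
    have hm : x - y ∈ R := by
      rw [← Submodule.ker_mkQ R, LinearMap.mem_ker, map_sub, hxy, sub_self]
    obtain ⟨u, hu, u', hu', huu⟩ := Submodule.mem_sup.1 (hgr hm)
    have h1 : x - u ∈ grade 0 ⊓ grade 1 :=
      ⟨sub_mem hx hu.2, by
        rw [show x - u = y + u' by rw [← sub_eq_iff_eq_add.2 huu.symm]; abel]
        exact add_mem hy hu'.2⟩
    rw [hinf, Submodule.mem_bot, sub_eq_zero] at h1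
    rw [Submodule.mem_bot, ← LinearMap.mem_ker, Submodule.ker_mkQ, h1]
    exact hu.1
  act_grade := by
    rintro a - p _ ⟨x, hx, rfl⟩
    exact ⟨act a x, hact a p x hx, by simp⟩
  act_br := by
    rintro a - b - v
    obtain ⟨w, rfl⟩ := R.mkQ_surjective v
    rw [sb_eq, Finsupp.smul_single, Finsupp.sum_single_index (by simp)]
    have := hrel a b w
    rw [← Submodule.Quotient.mk_eq_zero] at this
    simp only [Submodule.Quotient.mk_sub, Submodule.Quotient.mk_smul] at this
    simpa [sub_eq_zero] using this

lemma commutator_symm {W : Type*} [AddCommGroup W] [Module ℂ W] {a b : SB} {x y t : W}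
    {t' : W} (ht : t = t') (h : x = sgn a b • y + coef a b • t) :
    y = sgn b a • x + coef b a • t' := by
  have h2 := sgn_mul_self a b
  rw [coef_skew a b, sgn_comm b a, h, ← ht]
  linear_combination (norm := module) (-h2) • y

/-! ### Adjoining one odd generator -/

section OddExt

variable {α β : ℕ} (ρ : GRep (QS α β))

/-- The odd generator to be adjoined. -/
abbrev newG (β : ℕ) : SB := .g (-((β : ℤ) + 1))

/-- The action of `y` on the copy of `V` inside `V ⊕ G V`, where `G = newG β`. -/
noncomputable def extBase (y : SB) : ρ.V →ₗ[ℂ] ρ.V × ρ.V :=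
  if y = newG β then LinearMap.inr ℂ ρ.V ρ.V else LinearMap.inl ℂ ρ.V ρ.V ∘ₗ ρ.act y

/-- The action on `V ⊕ G V`, where `G = newG β`. -/
noncomputable def extAct (a : SB) : ρ.V × ρ.V →ₗ[ℂ] ρ.V × ρ.V :=
  (extBase ρ a).coprod
    (if a = newG β then LinearMap.inl ℂ ρ.V ρ.V ∘ₗ ρ.act (star a a)
     else sgn a (newG β) • (LinearMap.inr ℂ ρ.V ρ.V ∘ₗ ρ.act a)
      + coef a (newG β) • extBase ρ (star a (newG β)))

lemma newG_notMem : newG β ∉ QS α β := by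
  simp [newG, g_mem_QS]

lemma ne_newG {a : SB} (ha : a ∈ QS α β) : a ≠ newG β := by
  rintro rfl; exact newG_notMem ha

lemma mem_QS_succ {a : SB} (ha : a ∈ QS α (β + 1)) : a ∈ QS α β ∨ a = newG β := by
  rcases a with m | m | m <;> simp_all [l_mem_QS, i_mem_QS, g_mem_QS]
  omega

lemma QS_le_succ {a : SB} (ha : a ∈ QS α β) : a ∈ QS α (β + 1) := by
  rcases a with m | m | m <;> simp_all [l_mem_QS, i_mem_QS, g_mem_QS]
  omega

lemma newG_mem : newG β ∈ QS α (β + 1) := by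
  simp [newG, g_mem_QS]

lemma extBase_of_mem {a : SB} (ha : a ∈ QS α β) (v : ρ.V) :
    extBase ρ a v = LinearMap.inl ℂ ρ.V ρ.V (ρ.act a v) := by
  simp [extBase, ne_newG ha]

lemma extBase_newG (v : ρ.V) : extBase ρ (newG β) v = LinearMap.inr ℂ ρ.V ρ.V v := by
  simp [extBase]

lemma extAct_inl (a : SB) (v : ρ.V) :
    extAct ρ a (LinearMap.inl ℂ ρ.V ρ.V v) = extBase ρ a v := by
  simp [extAct]

lemma extAct_inr {a : SB} (ha : a ∈ QS α β) (w : ρ.V) :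
    extAct ρ a (LinearMap.inr ℂ ρ.V ρ.V w) =
      sgn a (newG β) • LinearMap.inr ℂ ρ.V ρ.V (ρ.act a w)
        + coef a (newG β) • extBase ρ (star a (newG β)) w := by
  simp [extAct, ne_newG ha]

lemma extAct_newG_inr (w : ρ.V) :
    extAct ρ (newG β) (LinearMap.inr ℂ ρ.V ρ.V w) =
      LinearMap.inl ℂ ρ.V ρ.V (ρ.act (star (newG β) (newG β)) w) := by
  simp [extAct]

variable {ρ} (hβ : 2 * (β + 1) ≤ α)
include hβ

lemma star_newG_mem : star (newG β) (newG β) ∈ QS α β := by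
  simp only [star, i_mem_QS]; omega

lemma extAct_extBase {a b : SB} (ha : a ∈ QS α (β + 1)) (hb : b ∈ QS α (β + 1)) (v : ρ.V) :
    extAct ρ a (extBase ρ b v) =
      sgn a b • extAct ρ b (extBase ρ a v) + coef a b • extBase ρ (star a b) v := by
  have key : ∀ {a : SB}, a ∈ QS α β → extAct ρ a (extBase ρ (newG β) v) =
      sgn a (newG β) • extAct ρ (newG β) (extBase ρ a v)
        + coef a (newG β) • extBase ρ (star a (newG β)) v := fun {a} ha => by
    rw [extBase_newG, extAct_inr ρ ha, extBase_of_mem ρ ha, extAct_inl, extBase_newG]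
  rcases mem_QS_succ ha with ha | rfl <;> rcases mem_QS_succ hb with hb | rfl
  · rw [extBase_of_mem ρ hb, extBase_of_mem ρ ha, extAct_inl, extAct_inl, extBase_of_mem ρ ha,
      extBase_of_mem ρ hb, act_act ρ ha hb, map_add, map_smul, map_smul]
    by_cases hc : coef a b = 0
    · simp [hc]
    · rw [extBase_of_mem ρ (QS_closed (by omega) ha hb hc)]
  · exact key ha
  · exact commutator_symm (by rw [star_comm]) (key hb)
  · rw [extBase_newG, extAct_newG_inr, extBase_of_mem ρ (star_newG_mem hβ)]
    simp only [sgn, par, coef, and_self, if_true]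
    module

lemma extAct_extAct {a b : SB} (ha : a ∈ QS α (β + 1)) (hb : b ∈ QS α (β + 1))
    (x : ρ.V × ρ.V) :
    extAct ρ a (extAct ρ b x) =
      sgn a b • extAct ρ b (extAct ρ a x) + coef a b • extAct ρ (star a b) x := by
  have base : ∀ {a b : SB}, a ∈ QS α (β + 1) → b ∈ QS α (β + 1) → ∀ v,
      coef a b • extAct ρ a (extBase ρ b v) =
      coef a b • (sgn a b • extAct ρ b (extBase ρ a v) + coef a b • extBase ρ (star a b) v) :=
    fun ha hb v => by rw [extAct_extBase hβ ha hb]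
  obtain ⟨v, w⟩ := x
  have hx : (v, w) = LinearMap.inl ℂ ρ.V ρ.V v + LinearMap.inr ℂ ρ.V ρ.V w := by simp
  suffices h : extAct ρ a (extAct ρ b (LinearMap.inr ℂ ρ.V ρ.V w)) =
      sgn a b • extAct ρ b (extAct ρ a (LinearMap.inr ℂ ρ.V ρ.V w))
        + coef a b • extAct ρ (star a b) (LinearMap.inr ℂ ρ.V ρ.V w) by
    rw [hx]
    simp only [map_add, extAct_inl, extAct_extBase hβ ha hb, h]
    module
  have even : ∀ {a b : SB}, a ∈ QS α β → b ∈ QS α β →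
      extAct ρ a (extAct ρ b (LinearMap.inr ℂ ρ.V ρ.V w)) =
      sgn a b • extAct ρ b (extAct ρ a (LinearMap.inr ℂ ρ.V ρ.V w))
        + coef a b • extAct ρ (star a b) (LinearMap.inr ℂ ρ.V ρ.V w) := fun {a b} ha hb => by
    have e : ∀ {a b : SB}, a ∈ QS α β → b ∈ QS α β →
        coef b (newG β) • extAct ρ a (extBase ρ (star b (newG β)) w) =
        coef b (newG β) • (sgn a (star b (newG β)) • extBase ρ (star b (newG β)) (ρ.act a w)
          + coef a (star b (newG β)) • extBase ρ (star a (star b (newG β))) w) :=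
      fun {a b} ha hb => by
      by_cases hc : coef b (newG β) = 0
      · simp [hc]
      · rw [extAct_extBase hβ (QS_le_succ ha) (QS_closed hβ (QS_le_succ hb) newG_mem hc),
          extBase_of_mem ρ ha, extAct_inl]
    have e3 : coef a b • extAct ρ (star a b) (LinearMap.inr ℂ ρ.V ρ.V w) =
        coef a b • (sgn (star a b) (newG β) • LinearMap.inr ℂ ρ.V ρ.V (ρ.act (star a b) w)
        + coef (star a b) (newG β) • extBase ρ (star (star a b) (newG β)) w) := by
      by_cases hc : coef a b = 0
      · simp [hc]
      · rw [extAct_inr ρ (QS_closed (by omega) ha hb hc)]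
    have j := jacobi a b (newG β)
    have s := sgn_mul_self a b
    rw [e3, extAct_inr ρ ha, extAct_inr ρ hb]
    simp only [map_add, map_smul, e ha hb, e hb ha, extAct_inr ρ ha, extAct_inr ρ hb,
      act_act ρ ha hb, sgn_star_right, sgn_star_left, star_assoc, star_left_comm a b,
      sgn_comm b a]
    linear_combination (norm := module) j • extBase ρ (star a (star b (newG β))) w
      - (s * sgn b (newG β) * coef a (newG β)) • extBase ρ (star a (newG β)) (ρ.act b w)
  have key : ∀ {a : SB}, a ∈ QS α β →
      extAct ρ a (extAct ρ (newG β) (LinearMap.inr ℂ ρ.V ρ.V w)) =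
      sgn a (newG β) • extAct ρ (newG β) (extAct ρ a (LinearMap.inr ℂ ρ.V ρ.V w))
        + coef a (newG β) • extAct ρ (star a (newG β)) (LinearMap.inr ℂ ρ.V ρ.V w) :=
    fun {a} ha => by
    have hgg : sgn (newG β) (newG β) = -1 := by simp [sgn, par]
    have hg2 : coef (newG β) (newG β) = 2 := rfl
    have e1 : coef a (newG β) • extAct ρ (star a (newG β)) (LinearMap.inr ℂ ρ.V ρ.V w) =
        coef a (newG β) • (-sgn a (newG β) • extAct ρ (newG β) (extBase ρ (star a (newG β)) w)
          + coef (star a (newG β)) (newG β) •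
            extBase ρ (star a (star (newG β) (newG β))) w) := by
      by_cases hc : coef a (newG β) = 0
      · simp [hc]
      · rw [← extBase_newG, extAct_extBase hβ
          (QS_closed hβ (QS_le_succ ha) newG_mem hc) newG_mem, sgn_star_left, hgg, star_assoc]
        module
    have j : coef a (star (newG β) (newG β)) =
        coef a (newG β) * coef (star a (newG β)) (newG β) := by
      have j := jacobi a (newG β) (newG β)
      rw [coef_skew (star a (newG β)) (newG β), sgn_star_left, hgg, hg2] at j
      linear_combination j / 2 +
        coef a (newG β) * coef (star a (newG β)) (newG β) / 2 * sgn_mul_self a (newG β)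
    have e2 : coef a (star (newG β) (newG β)) •
        LinearMap.inl ℂ ρ.V ρ.V (ρ.act (star a (star (newG β) (newG β))) w) =
        coef a (star (newG β) (newG β)) • extBase ρ (star a (star (newG β) (newG β))) w := by
      by_cases hc : coef a (star (newG β) (newG β)) = 0
      · simp [hc]
      · rw [extBase_of_mem ρ (QS_closed (by omega) ha (star_newG_mem hβ) hc)]
    have s := sgn_mul_self a (newG β)
    rw [e1, extAct_newG_inr, extAct_inl, extBase_of_mem ρ ha,
      act_act ρ ha (star_newG_mem hβ), extAct_inr ρ ha]
    simp only [map_add, map_smul, extAct_newG_inr, e2, sgn_star_right]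
    linear_combination (norm := module) j • extBase ρ (star a (star (newG β) (newG β))) w
  rcases mem_QS_succ ha with ha | rfl <;> rcases mem_QS_succ hb with hb | rfl
  · exact even ha hb
  · exact key ha
  · exact commutator_symm (by rw [star_comm]) (key hb)
  · rw [extAct_newG_inr, extAct_inl, extBase_newG, extAct_inr ρ (star_newG_mem hβ)]
    simp only [sgn, par, coef, star, and_self, if_true]
    simp
    module

omit hβ in
lemma extBase_grade {y : SB} (hy : y ∈ QS α (β + 1)) {p : ZMod 2} {v : ρ.V}
    (hv : v ∈ ρ.grade p) :
    extBase ρ y v ∈ (ρ.grade (par y + p)).prod (ρ.grade (par y + p + 1)) := by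
  rcases mem_QS_succ hy with hy | rfl
  · simpa [extBase_of_mem ρ hy] using ρ.act_grade y hy p v hv
  · have : par (newG β) + p + 1 = p := by simp only [par]; generalize p = q; decide +revert
    simpa [extBase_newG, this] using hv

lemma extAct_grade {a : SB} (ha : a ∈ QS α (β + 1)) {p : ZMod 2} {x : ρ.V × ρ.V}
    (hx : x ∈ (ρ.grade p).prod (ρ.grade (p + 1))) :
    extAct ρ a x ∈ (ρ.grade (par a + p)).prod (ρ.grade (par a + p + 1)) := by
  obtain ⟨v, w⟩ := x
  obtain ⟨hv, hw⟩ := hx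
  have hx : (v, w) = LinearMap.inl ℂ ρ.V ρ.V v + LinearMap.inr ℂ ρ.V ρ.V w := by simp
  rw [hx, map_add, extAct_inl]
  refine add_mem (extBase_grade ha hv) ?_
  rcases mem_QS_succ ha with ha | rfl
  · rw [extAct_inr ρ ha]
    refine add_mem (Submodule.smul_mem _ _ ?_) ?_
    · simpa [add_assoc] using ρ.act_grade a ha _ w hw
    · by_cases hc : coef a (newG β) = 0
      · simp [hc]
      · refine Submodule.smul_mem _ _ ?_
        have := extBase_grade (QS_closed hβ (QS_le_succ ha) newG_mem hc) hw
        rw [par_star] at this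
        have h2 : (2 : ZMod 2) = 0 := rfl
        have e : par a + par (newG β) + (p + 1) = par a + p := by
          rw [show par (newG β) = 1 from rfl]
          linear_combination h2
        rwa [e] at this
  · rw [extAct_newG_inr]
    have := ρ.act_grade _ (star_newG_mem hβ) _ w hw
    have e : par (star (newG β) (newG β)) + (p + 1) = par (newG β) + p := by
      simp only [star, par]; ring
    rw [e] at this
    simpa using this

variable (ρ) in
/-- The representation of `𝔖_{α,β+1}` induced from the representation `ρ` of `𝔖_{α,β}`. -/
noncomputable def oddExt : GRep (QS α (β + 1)) where
  V := ρ.V × ρ.V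
  act := extAct ρ
  grade p := (ρ.grade p).prod (ρ.grade (p + 1))
  grade_sup x := by
    obtain ⟨v, w⟩ := x
    obtain ⟨v0, h0, v1, h1, rfl⟩ := ρ.grade_sup v
    obtain ⟨w0, k0, w1, k1, rfl⟩ := ρ.grade_sup w
    exact ⟨(v0, w1), ⟨h0, k1⟩, (v1, w0), ⟨h1, k0⟩, by simp [add_comm]⟩
  grade_inf := by
    rw [Submodule.prod_inf_prod, ρ.grade_inf, inf_comm]
    erw [ρ.grade_inf]
    simp
  act_grade a ha p x hx := extAct_grade hβ ha hx
  act_br a ha b hb x := by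
    rw [extAct_extAct hβ ha hb, sb_eq, Finsupp.smul_single,
      Finsupp.sum_single_index (by simp)]
    simp

end OddExt

/-! ### Induction along a complementary subalgebra -/

section Free

variable {Q : Set SB} (ρ : GRep Q)

/-- Words with coefficients in `V`. -/
abbrev Word : Type := List SB →₀ ρ.V

/-- Prepending a letter. -/
noncomputable def consL (n : SB) : Word ρ →ₗ[ℂ] Word ρ :=
  Finsupp.lmapDomain ρ.V ℂ (List.cons n)

open Classical in
/-- The action of `c` on a word: letters outside `Q` are prepended, letters in `Q` are moved
to the right until they act on `V`. -/
noncomputable def opW : List SB → SB → ρ.V →ₗ[ℂ] Word ρ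
  | [], c => if c ∈ Q then Finsupp.lsingle [] ∘ₗ ρ.act c else Finsupp.lsingle [c]
  | n :: w, c =>
    if c ∈ Q then sgn c n • (consL ρ n ∘ₗ opW w c) + coef c n • opW w (star c n)
    else Finsupp.lsingle (c :: n :: w)

/-- The linear extension of `opW`. -/
noncomputable def op (c : SB) : Word ρ →ₗ[ℂ] Word ρ :=
  Finsupp.lsum ℂ fun w => opW ρ w c

@[simp] lemma consL_single (n : SB) (w : List SB) (v : ρ.V) :
    consL ρ n (Finsupp.single w v) = Finsupp.single (n :: w) v := by
  simp [consL]

lemma op_single (c : SB) (w : List SB) (v : ρ.V) :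
    op ρ c (Finsupp.single w v) = opW ρ w c v := by
  simp [op]

lemma op_of_notMem {c : SB} (hc : c ∉ Q) (x : Word ρ) : op ρ c x = consL ρ c x := by
  suffices h : op ρ c = consL ρ c by rw [h]
  ext w v : 2
  rcases w with _ | ⟨n, w⟩ <;> simp [op_single, opW, hc]

lemma op_nil {c : SB} (hc : c ∈ Q) (v : ρ.V) :
    op ρ c (Finsupp.single [] v) = Finsupp.single [] (ρ.act c v) := by
  simp [op_single, opW, hc]

lemma op_consL {c : SB} (hc : c ∈ Q) (n : SB) (x : Word ρ) :
    op ρ c (consL ρ n x) = sgn c n • consL ρ n (op ρ c x) + coef c n • op ρ (star c n) x := by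
  suffices h : op ρ c ∘ₗ consL ρ n =
      sgn c n • (consL ρ n ∘ₗ op ρ c) + coef c n • op ρ (star c n) from
    LinearMap.congr_fun h x
  ext w v : 2
  simp [op_single, opW, hc]

lemma word_induction {P : Submodule ℂ (Word ρ)} (h₀ : ∀ v, Finsupp.single [] v ∈ P)
    (h : ∀ n, ∀ x ∈ P, consL ρ n x ∈ P) (x : Word ρ) : x ∈ P := by
  have key : ∀ (w : List SB) (v : ρ.V), Finsupp.single w v ∈ P := by
    intro w v
    induction w with
    | nil => exact h₀ v
    | cons n w ih => simpa using h n _ ih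
  rw [← Finsupp.sum_single x]
  exact Submodule.sum_mem _ fun w _ => key w _

/-- The defect of the commutation relation of `a` and `b`. -/
noncomputable def defect (a b : SB) : Word ρ →ₗ[ℂ] Word ρ :=
  op ρ a ∘ₗ op ρ b - sgn a b • (op ρ b ∘ₗ op ρ a) - coef a b • op ρ (star a b)

lemma defect_apply (a b : SB) (x : Word ρ) : defect ρ a b x =
    op ρ a (op ρ b x) - sgn a b • op ρ b (op ρ a x) - coef a b • op ρ (star a b) x := by
  simp [defect]

lemma defect_skew (a b : SB) (x : Word ρ) : defect ρ b a x = -(sgn a b • defect ρ a b x) := by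
  have h := sgn_mul_self a b
  rw [defect_apply, defect_apply, coef_skew a b, sgn_comm b a, star_comm b a]
  linear_combination (norm := module) (-h) • op ρ b (op ρ a x)

lemma op_op_of_defect {a b : SB} {x : Word ρ} (h : defect ρ a b x = 0) :
    op ρ a (op ρ b x) = sgn a b • op ρ b (op ρ a x) + coef a b • op ρ (star a b) x := by
  rw [defect_apply] at h
  linear_combination (norm := module) h

lemma defect_of_mem_of_notMem {a b : SB} (ha : a ∈ Q) (hb : b ∉ Q) (x : Word ρ) :
    defect ρ a b x = 0 := by
  rw [defect_apply, op_of_notMem ρ hb, op_of_notMem ρ hb, op_consL ρ ha]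
  module

variable (hQ : ∀ a ∈ Q, ∀ b ∈ Q, coef a b ≠ 0 → star a b ∈ Q)
include hQ

lemma defect_of_mem_of_mem (x : Word ρ) :
    ∀ {a b : SB}, a ∈ Q → b ∈ Q → defect ρ a b x = 0 := by
  let P : Submodule ℂ (Word ρ) := ⨅ a ∈ Q, ⨅ b ∈ Q, LinearMap.ker (defect ρ a b)
  have hP : ∀ x, x ∈ P ↔ ∀ a ∈ Q, ∀ b ∈ Q, defect ρ a b x = 0 := by
    simp [P, Submodule.mem_iInf]
  suffices h : x ∈ P from fun {a b} ha hb => (hP x).1 h a ha b hb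
  refine word_induction ρ (fun v => ?_) (fun n x hx => ?_) x
  · rw [hP]
    intro a ha b hb
    rw [defect_apply, op_nil ρ hb, op_nil ρ ha, op_nil ρ ha, op_nil ρ hb, act_act ρ ha hb,
      Finsupp.single_add, ← Finsupp.smul_single, ← Finsupp.smul_single]
    by_cases hc : coef a b = 0
    · simp [hc]
    · rw [op_nil ρ (hQ a ha b hb hc)]
      module
  · rw [hP] at hx ⊢
    intro a ha b hb
    have rel : ∀ {a : SB}, a ∈ Q → ∀ b, op ρ a (op ρ b x) =
        sgn a b • op ρ b (op ρ a x) + coef a b • op ρ (star a b) x := fun {a} ha b =>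
      op_op_of_defect ρ <| by
        by_cases hb : b ∈ Q
        · exact hx a ha b hb
        · exact defect_of_mem_of_notMem ρ ha hb x
    have e : coef a b • op ρ (star a b) (consL ρ n x) = coef a b •
        (sgn (star a b) n • consL ρ n (op ρ (star a b) x)
          + coef (star a b) n • op ρ (star (star a b) n) x) := by
      by_cases hc : coef a b = 0
      · simp [hc]
      · rw [op_consL ρ (hQ a ha b hb hc)]
    have j := jacobi a b n
    have s := sgn_mul_self a b
    rw [defect_apply, e, op_consL ρ ha, op_consL ρ hb]
    simp only [map_add, map_smul, op_consL ρ ha, op_consL ρ hb, rel ha b,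
      rel ha (star b n), rel hb (star a n),
      sgn_star_right, sgn_star_left, star_assoc, star_left_comm a b, sgn_comm b a]
    linear_combination (norm := module) j • op ρ (star a (star b n)) x
      - (s * sgn b n * coef a n) • op ρ (star a n) (op ρ b x)

lemma defect_of_mem {a : SB} (ha : a ∈ Q) (b : SB) (x : Word ρ) : defect ρ a b x = 0 := by
  by_cases hb : b ∈ Q
  · exact defect_of_mem_of_mem ρ hQ x ha hb
  · exact defect_of_mem_of_notMem ρ ha hb x

lemma op_op {a : SB} (ha : a ∈ Q) (b : SB) (x : Word ρ) :
    op ρ a (op ρ b x) = sgn a b • op ρ b (op ρ a x) + coef a b • op ρ (star a b) x :=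
  op_op_of_defect ρ (defect_of_mem ρ hQ ha b x)

lemma op_defect {a : SB} (ha : a ∈ Q) (b c : SB) (x : Word ρ) :
    op ρ a (defect ρ b c x) = (sgn a b * sgn a c) • defect ρ b c (op ρ a x)
      + coef a b • defect ρ (star a b) c x
      + (sgn a b * coef a c) • defect ρ b (star a c) x := by
  have j := jacobi a b c
  have s := sgn_mul_self a b
  simp only [defect_apply, map_sub, map_smul, map_add, op_op ρ hQ ha, sgn_star_right,
    sgn_star_left, star_assoc, star_left_comm a b, sgn_comm b a]
  linear_combination (norm := module) (-j) • op ρ (star a (star b c)) x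
    + (s * sgn b c * coef a c) • op ρ (star a c) (op ρ b x)

omit hQ in
/-- The defects of the letters outside `Q`. -/
def defects : Set (Word ρ) := {y | ∃ a ∉ Q, ∃ b ∉ Q, ∃ x, y = defect ρ a b x}

omit hQ in
/-- The subspace of relations among words. -/
noncomputable def relations : Submodule ℂ (Word ρ) :=
  gen (consL ρ) Set.univ (defects ρ)

lemma defect_mem_relations (a b : SB) (x : Word ρ) : defect ρ a b x ∈ relations ρ := by
  by_cases ha : a ∈ Q
  · rw [defect_of_mem ρ hQ ha]; exact zero_mem _
  by_cases hb : b ∈ Q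
  · rw [defect_skew, defect_of_mem ρ hQ hb]; simp
  · exact subset_gen ⟨a, ha, b, hb, x, rfl⟩

lemma op_mem_relations (a : SB) {x : Word ρ} (hx : x ∈ relations ρ) :
    op ρ a x ∈ relations ρ := by
  let P : Submodule ℂ (Word ρ) := ⨅ a, (relations ρ).comap (op ρ a)
  have hP : ∀ x, x ∈ P ↔ ∀ a, op ρ a x ∈ relations ρ := by simp [P, Submodule.mem_iInf]
  have hcons : ∀ n, ∀ x ∈ relations ρ, consL ρ n x ∈ relations ρ :=
    fun n x hx => act_mem_gen (Set.mem_univ n) hx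
  suffices h : relations ρ ≤ P from (hP x).1 (h hx) a
  refine gen_le ?_ ?_
  · rintro _ ⟨b, hb, c, hc, x, rfl⟩
    refine (hP _).2 fun a => ?_
    by_cases ha : a ∈ Q
    · rw [op_defect ρ hQ ha]
      exact add_mem (add_mem (Submodule.smul_mem _ _ (defect_mem_relations ρ hQ _ _ _))
        (Submodule.smul_mem _ _ (defect_mem_relations ρ hQ _ _ _)))
        (Submodule.smul_mem _ _ (defect_mem_relations ρ hQ _ _ _))
    · rw [op_of_notMem ρ ha]
      exact hcons _ _ (defect_mem_relations ρ hQ _ _ _)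
  · intro n _ x hx hxP
    rw [hP] at hxP ⊢
    intro a
    by_cases ha : a ∈ Q
    · rw [op_consL ρ ha]
      exact add_mem (Submodule.smul_mem _ _ (hcons _ _ (hxP _)))
        (Submodule.smul_mem _ _ (hxP _))
    · rw [op_of_notMem ρ ha]
      exact hcons _ _ (hcons _ _ hx)

omit hQ in
/-- If the span of the complement of `Q` is a subalgebra, relations have no constant term. -/
lemma relations_apply_nil (hQ' : ∀ a ∉ Q, ∀ b ∉ Q, coef a b ≠ 0 → star a b ∉ Q)
    {x : Word ρ} (hx : x ∈ relations ρ) : x [] = 0 := by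
  have hcons : ∀ n x, consL ρ n x [] = 0 := fun n x =>
    Finsupp.mapDomain_of_notMem_range _ _ (by simp)
  suffices h : relations ρ ≤ LinearMap.ker (Finsupp.lapply (R := ℂ) (M := ρ.V) []) from h hx
  refine gen_le ?_ ?_
  · rintro _ ⟨a, ha, b, hb, x, rfl⟩
    rw [LinearMap.mem_ker, Finsupp.lapply_apply, defect_apply]
    by_cases hc : coef a b = 0
    · simp [op_of_notMem ρ ha, op_of_notMem ρ hb, hc, hcons]
    · simp [op_of_notMem ρ ha, op_of_notMem ρ hb, op_of_notMem ρ (hQ' a ha b hb hc), hcons]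
  · intro n _ x _ _
    exact hcons n x

omit hQ in
/-- The grading of the space of words. -/
noncomputable def wordGrade (p : ZMod 2) : Submodule ℂ (Word ρ) where
  carrier := {x | ∀ w, x w ∈ ρ.grade (p + (w.map par).sum)}
  add_mem' hx hy w := add_mem (hx w) (hy w)
  zero_mem' _ := zero_mem _
  smul_mem' c _ hx w := Submodule.smul_mem _ c (hx w)

omit hQ in
lemma single_mem_wordGrade {p : ZMod 2} {w : List SB} {v : ρ.V}
    (hv : v ∈ ρ.grade (p + (w.map par).sum)) : Finsupp.single w v ∈ wordGrade ρ p := by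
  intro w'
  rw [Finsupp.single_apply]
  split_ifs with h
  · exact h ▸ hv
  · exact zero_mem _

omit hQ in
lemma wordGrade_le {p : ZMod 2} {P : Submodule ℂ (Word ρ)}
    (h : ∀ w, ∀ v ∈ ρ.grade (p + (w.map par).sum), Finsupp.single w v ∈ P) :
    wordGrade ρ p ≤ P := by
  intro x hx
  rw [← Finsupp.sum_single x]
  exact Submodule.sum_mem _ fun w _ => h w _ (hx w)

omit hQ in
lemma zmod_two_cancel (a b c : ZMod 2) : a + b + (a + c) = b + c := by decide +revert

omit hQ in
lemma consL_grade (n : SB) {p : ZMod 2} {x : Word ρ} (hx : x ∈ wordGrade ρ p) :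
    consL ρ n x ∈ wordGrade ρ (par n + p) := by
  suffices h : wordGrade ρ p ≤ (wordGrade ρ (par n + p)).comap (consL ρ n) from h hx
  refine wordGrade_le ρ fun w v hv => ?_
  rw [Submodule.mem_comap, consL_single]
  exact single_mem_wordGrade ρ (by simpa [zmod_two_cancel] using hv)

omit hQ in
lemma opW_grade (w : List SB) {p : ZMod 2} {v : ρ.V} (c : SB)
    (hv : v ∈ ρ.grade (p + (w.map par).sum)) : opW ρ w c v ∈ wordGrade ρ (par c + p) := by
  by_cases hc : c ∈ Q
  · induction w generalizing c p with
    | nil =>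
      simp only [opW, hc, if_true]
      exact single_mem_wordGrade ρ (by simpa using ρ.act_grade c hc _ v (by simpa using hv))
    | cons n w ih =>
      have hv' : v ∈ ρ.grade (par n + p + (w.map par).sum) := by
        convert hv using 2
        simp only [List.map_cons, List.sum_cons]
        ring
      have h2 : (2 : ZMod 2) = 0 := rfl
      have ih' : ∀ c, opW ρ w c v ∈ wordGrade ρ (par c + (par n + p)) := fun c => by
        by_cases hc : c ∈ Q
        · exact ih c hv' hc
        · rw [← op_single, op_of_notMem ρ hc]
          exact consL_grade ρ c (single_mem_wordGrade ρ hv')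
      simp only [opW, hc, if_true]
      refine add_mem (Submodule.smul_mem _ _ ?_) (Submodule.smul_mem _ _ ?_)
      · have := consL_grade ρ n (ih' c)
        rwa [show par n + (par c + (par n + p)) = par c + p by
          linear_combination par n * h2] at this
      · have := ih' (star c n)
        rwa [par_star, show par c + par n + (par n + p) = par c + p by
          linear_combination par n * h2] at this
  · rw [← op_single, op_of_notMem ρ hc]
    exact consL_grade ρ c (single_mem_wordGrade ρ hv)

omit hQ in
lemma op_grade (c : SB) (p : ZMod 2) (x : Word ρ) (hx : x ∈ wordGrade ρ p) :
    op ρ c x ∈ wordGrade ρ (par c + p) := by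
  suffices h : wordGrade ρ p ≤ (wordGrade ρ (par c + p)).comap (op ρ c) from h hx
  refine wordGrade_le ρ fun w v hv => ?_
  rw [Submodule.mem_comap, op_single]
  exact opW_grade ρ w c hv

omit hQ in
lemma wordGrade_sup (x : Word ρ) :
    ∃ x0 ∈ wordGrade ρ 0, ∃ x1 ∈ wordGrade ρ 1, x = x0 + x1 := by
  suffices h : x ∈ wordGrade ρ 0 ⊔ wordGrade ρ 1 by
    obtain ⟨y, hy, z, hz, h⟩ := Submodule.mem_sup.1 h
    exact ⟨y, hy, z, hz, h.symm⟩
  refine word_induction ρ (fun v => ?_) (fun n x hx => ?_) x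
  · obtain ⟨v0, h0, v1, h1, rfl⟩ := ρ.grade_sup v
    rw [Finsupp.single_add]
    exact Submodule.add_mem_sup (single_mem_wordGrade ρ (by simpa using h0))
      (single_mem_wordGrade ρ (by simpa using h1))
  · have hle : ∀ p, wordGrade ρ p ≤ wordGrade ρ 0 ⊔ wordGrade ρ 1 := by
      intro p
      fin_cases p
      · exact le_sup_left
      · exact le_sup_right
    obtain ⟨y, hy, z, hz, rfl⟩ := Submodule.mem_sup.1 hx
    rw [map_add]
    exact add_mem (hle _ (consL_grade ρ n hy)) (hle _ (consL_grade ρ n hz))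

omit hQ in
lemma wordGrade_inf : wordGrade ρ 0 ⊓ wordGrade ρ 1 = ⊥ := by
  rw [eq_bot_iff]
  rintro x ⟨h0, h1⟩
  rw [Submodule.mem_bot]
  ext w
  have h0 := h0 w
  have h1 := h1 w
  generalize (w.map par).sum = s at h0 h1
  have : x w ∈ ρ.grade 0 ⊓ ρ.grade 1 := by
    fin_cases s
    · exact ⟨h0, h1⟩
    · exact ⟨h1, h0⟩
  rwa [ρ.grade_inf, Submodule.mem_bot] at this

omit hQ in
lemma isGraded_relations : IsGraded (wordGrade ρ) (relations ρ) := by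
  refine isGraded_gen ?_ fun a _ p => ⟨_, fun x hx => consL_grade ρ a hx⟩
  rintro _ ⟨a, ha, b, hb, x, rfl⟩
  have key : ∀ p, ∀ x ∈ wordGrade ρ p, defect ρ a b x ∈
      (relations ρ ⊓ wordGrade ρ 0) ⊔ (relations ρ ⊓ wordGrade ρ 1) := by
    intro p x hx
    refine inf_grade_le _ _ (par a + (par b + p)) ⟨subset_gen ⟨a, ha, b, hb, x, rfl⟩, ?_⟩
    rw [defect_apply]
    refine sub_mem (sub_mem (op_grade ρ _ _ _ (op_grade ρ _ _ _ hx))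
      (Submodule.smul_mem _ _ ?_)) (Submodule.smul_mem _ _ ?_)
    · rw [add_left_comm]
      exact op_grade ρ _ _ _ (op_grade ρ _ _ _ hx)
    · rw [← add_assoc, ← par_star]
      exact op_grade ρ _ _ _ hx
  obtain ⟨x0, h0, x1, h1, rfl⟩ := wordGrade_sup ρ x
  rw [map_add]
  exact add_mem (key 0 x0 h0) (key 1 x1 h1)

lemma exists_embedding_of_complement
    (hQ' : ∀ a ∉ Q, ∀ b ∉ Q, coef a b ≠ 0 → star a b ∉ Q) :
    ∃ (N : GRep (Set.univ : Set SB)) (f : ρ.V →ₗ[ℂ] N.V),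
      SEquivMap Q ρ N f ∧ Function.Injective f := by
  have hinj : Function.Injective ((relations ρ).mkQ ∘ₗ Finsupp.lsingle (M := ρ.V) []) := by
    rw [← LinearMap.ker_eq_bot, eq_bot_iff]
    intro v hv
    rw [LinearMap.mem_ker, LinearMap.comp_apply, ← LinearMap.mem_ker, Submodule.ker_mkQ] at hv
    simpa using relations_apply_nil ρ hQ' hv
  let N := quotRep (op ρ) (wordGrade ρ) (wordGrade_sup ρ) (wordGrade_inf ρ) (op_grade ρ)
    (relations ρ) (fun a x hx => op_mem_relations ρ hQ a hx) (isGraded_relations ρ)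
    (fun a b x => by
      rw [← defect_apply]
      exact defect_mem_relations ρ hQ a b x)
  refine ⟨N, (relations ρ).mkQ ∘ₗ Finsupp.lsingle [], ⟨fun a ha v => ?_, fun p v hv => ?_⟩, hinj⟩
  · exact (congrArg (relations ρ).mkQ (op_nil ρ ha v)).symm
  · exact ⟨_, single_mem_wordGrade ρ (by simpa using hv), rfl⟩

end Free

lemma exists_embedding {α β : ℕ} (h : 2 * β ≤ α) (ρ : GRep (QS α β)) :
    ∃ (N : GRep (Set.univ : Set SB)) (f : ρ.V →ₗ[ℂ] N.V),
      SEquivMap (QS α β) ρ N f ∧ Function.Injective f := by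
  induction hk : α - 2 * β using Nat.strong_induction_on generalizing β with
  | _ k ih =>
  by_cases hβ : 2 * (β + 1) ≤ α
  · obtain ⟨N, f, hf, hinj⟩ := ih _ (by omega) hβ (oddExt ρ hβ) rfl
    refine ⟨N, f ∘ₗ LinearMap.inl ℂ ρ.V ρ.V, ⟨fun a ha v => ?_, fun p v hv => ?_⟩,
      hinj.comp LinearMap.inl_injective⟩
    · exact (congrArg f ((extAct_inl ρ a v).trans (extBase_of_mem ρ ha v)).symm).trans
        (hf.1 a (QS_le_succ ha) _)
    · exact hf.2 p _ ⟨hv, zero_mem _⟩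
  · refine exists_embedding_of_complement ρ (fun a ha b hb => QS_closed h ha hb) ?_
    rintro (m | m | m) ha (n | n | n) hb <;>
      simp_all [l_mem_QS, i_mem_QS, g_mem_QS, star, coef] <;> omega

/-! ### A ladder argument -/

section Ladder

variable {W : Type*} [AddCommGroup W] [Module ℂ W] {X D E : Module.End ℂ W} {c : ℂ}
  {A : Submodule ℂ W}

/-- The span of the vectors `X ^ i a` with `a ∈ A` and `i ≤ n`. -/
def ladder (X : Module.End ℂ W) (A : Submodule ℂ W) : ℕ → Submodule ℂ W
  | 0 => A
  | n + 1 => ladder X A n ⊔ A.map (X ^ (n + 1))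

lemma ladder_mono : Monotone (ladder X A) :=
  monotone_nat_of_le_succ fun _ => le_sup_left

lemma pow_mem_ladder (n : ℕ) {a : W} (ha : a ∈ A) : (X ^ n) a ∈ ladder X A n := by
  cases n with
  | zero => exact ha
  | succ n => exact Submodule.mem_sup_right (Submodule.mem_map_of_mem ha)

lemma ladder_le {P : Submodule ℂ W} (h : ∀ n, ∀ a ∈ A, (X ^ n) a ∈ P) (n : ℕ) :
    ladder X A n ≤ P := by
  induction n with
  | zero => exact h 0
  | succ n ih =>
    refine sup_le ih ?_
    rintro _ ⟨a, ha, rfl⟩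
    exact h _ a ha

lemma apply_pow_comm {T : Module.End ℂ W} (hT : ∀ x, T (X x) = X (T x)) (n : ℕ) (x : W) :
    T ((X ^ n) x) = (X ^ n) (T x) := by
  induction n with
  | zero => rfl
  | succ n ih => rw [pow_succ', Module.End.mul_apply, Module.End.mul_apply, hT, ih]

variable (hDX : ∀ x, D (X x) = X (D x) + c • E x) (hEX : ∀ x, E (X x) = X (E x))
  (hD : ∀ a ∈ A, D a = 0) (hE : ∀ a ∈ A, E a ∈ A)

include hDX hEX hD in
lemma lower_pow_succ (n : ℕ) {a : W} (ha : a ∈ A) :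
    D ((X ^ (n + 1)) a) = ((n + 1) * c) • (X ^ n) (E a) := by
  induction n with
  | zero => simp [hDX, hD a ha]
  | succ n ih =>
    rw [pow_succ', Module.End.mul_apply, hDX, ih, apply_pow_comm hEX, map_smul,
      ← Module.End.mul_apply, ← pow_succ']
    push_cast
    module

include hDX hEX hD hE in
lemma lower_pow_pow (n : ℕ) {a : W} (ha : a ∈ A) :
    (D ^ n) ((X ^ n) a) = (n.factorial * c ^ n) • (E ^ n) a := by
  induction n generalizing a with
  | zero => simp
  | succ n ih =>
    rw [pow_succ D, Module.End.mul_apply, lower_pow_succ hDX hEX hD n ha, map_smul,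
      ih (hE a ha), smul_smul, pow_succ E, Module.End.mul_apply, Nat.factorial_succ]
    push_cast
    congr 1
    ring

include hDX hEX hD hE in
lemma lower_pow_pow_of_lt {m n : ℕ} (h : n < m) {a : W} (ha : a ∈ A) :
    (D ^ m) ((X ^ n) a) = 0 := by
  obtain ⟨k, rfl⟩ := Nat.exists_eq_add_of_lt h
  have hmem : (E ^ n) a ∈ A := by
    clear h
    induction n generalizing a with
    | zero => exact ha
    | succ n ih =>
      rw [pow_succ, Module.End.mul_apply]
      exact ih (hE a ha)
  rw [show n + k + 1 = k + 1 + n by ring, pow_add, Module.End.mul_apply,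
    lower_pow_pow hDX hEX hD hE n ha, map_smul, pow_succ, Module.End.mul_apply, hD _ hmem]
  simp

include hDX hEX hD hE in
lemma eq_zero_of_mem_ladder (hc : c ≠ 0) (hinj : ∀ a ∈ A, E a = 0 → a = 0)
    {U : Submodule ℂ W} (hUD : ∀ x ∈ U, D x ∈ U) (hU : ∀ x ∈ U, x ∈ A → x = 0) (n : ℕ) :
    ∀ x ∈ U, x ∈ ladder X A n → x = 0 := by
  have hEpow : ∀ n, ∀ a ∈ A, (E ^ n) a ∈ A ∧ ((E ^ n) a = 0 → a = 0) := by
    intro n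
    induction n with
    | zero => exact fun a ha => ⟨ha, id⟩
    | succ n ih =>
      intro a ha
      rw [pow_succ, Module.End.mul_apply]
      exact ⟨(ih _ (hE a ha)).1, fun h => hinj a ha ((ih _ (hE a ha)).2 h)⟩
  have hDpow : ∀ n, ∀ x ∈ U, (D ^ n) x ∈ U := by
    intro n
    induction n with
    | zero => exact fun x hx => hx
    | succ n ih =>
      intro x hx
      rw [pow_succ, Module.End.mul_apply]
      exact ih _ (hUD x hx)
  induction n with
  | zero => exact hU
  | succ n ih =>
    intro x hxU hx
    obtain ⟨y, hy, _, ⟨a, ha, rfl⟩, rfl⟩ := Submodule.mem_sup.1 hx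
    have hy0 : (D ^ (n + 1)) y = 0 := by
      have hle : ∀ k ≤ n, ladder X A k ≤ LinearMap.ker (D ^ (n + 1)) := by
        intro k
        induction k with
        | zero => exact fun _ a ha => lower_pow_pow_of_lt hDX hEX hD hE (Nat.succ_pos n) ha
        | succ k ihk =>
          intro hk
          refine sup_le (ihk (by omega)) ?_
          rintro _ ⟨a, ha, rfl⟩
          exact lower_pow_pow_of_lt hDX hEX hD hE (by omega) ha
      exact hle n le_rfl hy
    have h := hDpow (n + 1) _ hxU
    have hne : ((n + 1).factorial * c ^ (n + 1) : ℂ) ≠ 0 :=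
      mul_ne_zero (by exact_mod_cast Nat.factorial_ne_zero _) (pow_ne_zero _ hc)
    rw [map_add, hy0, zero_add, lower_pow_pow hDX hEX hD hE _ ha,
      Submodule.smul_mem_iff _ hne] at h
    obtain rfl : a = 0 := (hEpow _ a ha).2 (hU _ h (hEpow _ a ha).1)
    rw [map_zero, add_zero] at hxU ⊢
    exact ih y hxU hy

end Ladder

/-! ### Commutation relations in an 𝔖-module -/

section Relations

variable (M : GRep (Set.univ : Set SB)) (m n : ℤ) (x : M.V)

lemma i_i : M.act (.i m) (M.act (.i n) x) = M.act (.i n) (M.act (.i m) x) := by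
  simpa [sgn, par, coef] using act_act M (Set.mem_univ (.i m)) (Set.mem_univ (.i n)) x

lemma i_g : M.act (.i m) (M.act (.g n) x) = M.act (.g n) (M.act (.i m) x) := by
  simpa [sgn, par, coef] using act_act M (Set.mem_univ (.i m)) (Set.mem_univ (.g n)) x

lemma i_l : M.act (.i m) (M.act (.l n) x) =
    M.act (.l n) (M.act (.i m) x) - (m : ℂ) • M.act (.i (m + n)) x := by
  simpa [sgn, par, coef, star, sub_eq_add_neg] using
    act_act M (Set.mem_univ (.i m)) (Set.mem_univ (.l n)) x

lemma l_i : M.act (.l m) (M.act (.i n) x) =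
    M.act (.i n) (M.act (.l m) x) + (n : ℂ) • M.act (.i (m + n)) x := by
  simpa [sgn, par, coef, star] using act_act M (Set.mem_univ (.l m)) (Set.mem_univ (.i n)) x

lemma l_l : M.act (.l m) (M.act (.l n) x) =
    M.act (.l n) (M.act (.l m) x) + ((n : ℂ) - m) • M.act (.l (m + n)) x := by
  simpa [sgn, par, coef, star] using act_act M (Set.mem_univ (.l m)) (Set.mem_univ (.l n)) x

lemma g_g : M.act (.g m) (M.act (.g n) x) =
    -M.act (.g n) (M.act (.g m) x) + (2 : ℂ) • M.act (.i (m + n)) x := by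
  simpa [sgn, par, coef, star] using act_act M (Set.mem_univ (.g m)) (Set.mem_univ (.g n)) x

end Relations

lemma act_mem_gen_of {M : GRep (Set.univ : Set SB)} {S : Set SB} {W₀ : Set M.V} (c : SB)
    (h₀ : ∀ x ∈ W₀, M.act c x ∈ gen M.act S W₀)
    (h : ∀ s ∈ S, coef c s ≠ 0 → star c s ∈ S) {x : M.V} (hx : x ∈ gen M.act S W₀) :
    M.act c x ∈ gen M.act S W₀ := by
  suffices h : gen M.act S W₀ ≤ (gen M.act S W₀).comap (M.act c) from h hx
  refine gen_le h₀ fun s hs x hx hx' => ?_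
  rw [Submodule.mem_comap, act_act M (Set.mem_univ c) (Set.mem_univ s)]
  refine add_mem (Submodule.smul_mem _ _ (act_mem_gen hs hx')) ?_
  by_cases hc : coef c s = 0
  · simp [hc]
  · exact Submodule.smul_mem _ _ (act_mem_gen (h s hs hc) hx)

lemma act_eq_zero_of_mem_gen {M : GRep (Set.univ : Set SB)} {S : Set SB} {W₀ : Set M.V}
    (c : SB) (h₀ : ∀ x ∈ W₀, M.act c x = 0)
    (h : ∀ s ∈ S, coef c s ≠ 0 → ∀ x ∈ gen M.act S W₀, M.act (star c s) x = 0) {x : M.V}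
    (hx : x ∈ gen M.act S W₀) : M.act c x = 0 := by
  suffices h : gen M.act S W₀ ≤ LinearMap.ker (M.act c) from h hx
  refine gen_le h₀ fun s hs x hx hx' => ?_
  rw [LinearMap.mem_ker] at hx' ⊢
  rw [act_act M (Set.mem_univ c) (Set.mem_univ s), hx', map_zero, smul_zero, zero_add]
  by_cases hc : coef c s = 0
  · simp [hc]
  · rw [h s hs hc x hx, smul_zero]

/-! ### The action of the Heisenberg-Clifford part -/

/-- The set of all `I_m` with `m ∈ p` and all `G_m` with `m ∈ q`. -/
def heis (p q : Set ℤ) : Set SB := fun x =>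
  match x with
  | .l _ => False
  | .i m => m ∈ p
  | .g m => m ∈ q

lemma heis_mono {p p' q q' : Set ℤ} (hp : p ⊆ p') (hq : q ⊆ q') : heis p q ⊆ heis p' q' := by
  rintro (m | m | m) h
  · exact h
  · exact hp h
  · exact hq h

/-- The hypotheses on the subspace `W₀` of `M`. -/
structure Truncated (M : GRep (Set.univ : Set SB)) (α β z : ℕ) (W₀ : Submodule ℂ M.V) :
    Prop where
  stable : ∀ a ∈ QS α β, ∀ x ∈ W₀, M.act a x ∈ W₀
  inj : ∀ x ∈ W₀, M.act (.i z) x = 0 → x = 0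
  l_zero : ∀ j : ℤ, (z : ℤ) + α < j → ∀ x ∈ W₀, M.act (.l j) x = 0
  g_zero : ∀ j : ℤ, (z : ℤ) + β < j → ∀ x ∈ W₀, M.act (.g j) x = 0
  i_zero : ∀ j : ℤ, (z : ℤ) < j → ∀ x ∈ W₀, M.act (.i j) x = 0

section Heisenberg

variable {M : GRep (Set.univ : Set SB)} {α β z : ℕ} {W₀ : Submodule ℂ M.V}

/-- The subspace generated from `W₀` by the `I_m` with `m ∈ p` and the `G_m` with `m ∈ q`. -/
abbrev hgen (W₀ : Submodule ℂ M.V) (p q : Set ℤ) : Submodule ℂ M.V :=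
  gen M.act (heis p q) (W₀ : Set M.V)

lemma i_mem_hgen {p q : Set ℤ} {m : ℤ} (hm : m ∈ p) {x : M.V} (hx : x ∈ hgen W₀ p q) :
    M.act (.i m) x ∈ hgen W₀ p q :=
  act_mem_gen (show SB.i m ∈ heis p q from hm) hx

lemma g_mem_hgen {p q : Set ℤ} {m : ℤ} (hm : m ∈ q) {x : M.V} (hx : x ∈ hgen W₀ p q) :
    M.act (.g m) x ∈ hgen W₀ p q :=
  act_mem_gen (show SB.g m ∈ heis p q from hm) hx

lemma hgen_le {p q : Set ℤ} {P : Submodule ℂ M.V} (h₀ : W₀ ≤ P)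
    (hi : ∀ m ∈ p, ∀ x ∈ hgen W₀ p q, x ∈ P → M.act (.i m) x ∈ P)
    (hg : ∀ m ∈ q, ∀ x ∈ hgen W₀ p q, x ∈ P → M.act (.g m) x ∈ P) : hgen W₀ p q ≤ P := by
  refine gen_le h₀ ?_
  rintro (m | m | m) hm
  · exact hm.elim
  · exact hi m hm
  · exact hg m hm

/-- Every subspace stable under the `L_j`, `j > z + α`, and the `G_j`, `j > z + β`, which
meets `F` nontrivially meets `W₀` nontrivially. -/
def Detects (α β z : ℕ) (W₀ F : Submodule ℂ M.V) : Prop :=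
  ∀ U : Submodule ℂ M.V, (∀ j : ℤ, (z : ℤ) + α < j → ∀ x ∈ U, M.act (.l j) x ∈ U) →
    (∀ j : ℤ, (z : ℤ) + β < j → ∀ x ∈ U, M.act (.g j) x ∈ U) →
    (∀ x ∈ U, x ∈ W₀ → x = 0) → ∀ x ∈ U, x ∈ F → x = 0

namespace Truncated

variable (H : Truncated M α β z W₀)
include H

lemma i_eq_zero {p q : Set ℤ} {j : ℤ} (hj : z < j) {x : M.V} (hx : x ∈ hgen W₀ p q) :
    M.act (.i j) x = 0 := by
  refine act_eq_zero_of_mem_gen _ (H.i_zero j hj) ?_ hx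
  rintro (m | m | m) hm hc
  · exact hm.elim
  · exact absurd rfl hc
  · exact absurd rfl hc

lemma l_eq_zero {p : Set ℤ} {j : ℤ} (hj : z + α < j) (hp : ∀ m ∈ p, z < j + m) {x : M.V}
    (hx : x ∈ hgen W₀ p ∅) : M.act (.l j) x = 0 := by
  refine act_eq_zero_of_mem_gen _ (H.l_zero j hj) ?_ hx
  rintro (m | m | m) hm hc x hx
  · exact hm.elim
  · exact H.i_eq_zero (hp m hm) hx
  · exact hm.elim

lemma g_eq_zero {p q : Set ℤ} {j : ℤ} (hj : z + β < j) (hq : ∀ m ∈ q, z < j + m) {x : M.V}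
    (hx : x ∈ hgen W₀ p q) : M.act (.g j) x = 0 := by
  refine act_eq_zero_of_mem_gen _ (H.g_zero j hj) ?_ hx
  rintro (m | m | m) hm hc x hx
  · exact hm.elim
  · exact absurd rfl hc
  · exact H.i_eq_zero (hq m hm) hx

lemma l_mem_hgen {j : ℤ} (hj : 0 ≤ j) {x : M.V} (hx : x ∈ hgen W₀ Set.univ Set.univ) :
    M.act (.l j) x ∈ hgen W₀ Set.univ Set.univ := by
  refine act_mem_gen_of _ (fun x hx => subset_gen (H.stable (.l j) hj x hx)) ?_ hx
  rintro (m | m | m) hm -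
  · exact hm.elim
  · trivial
  · trivial

lemma inj_of_detects {p q : Set ℤ} (h : Detects α β z W₀ (hgen W₀ p q)) {x : M.V}
    (hx : x ∈ hgen W₀ p q) (h0 : M.act (.i z) x = 0) : x = 0 := by
  refine h (LinearMap.ker (M.act (.i z)) ⊓ hgen W₀ Set.univ Set.univ) ?_ ?_ ?_ x
    ⟨h0, gen_mono (heis_mono (Set.subset_univ p) (Set.subset_univ q)) hx⟩ hx
  · rintro j hj x ⟨h0, hx⟩
    rw [SetLike.mem_coe, LinearMap.mem_ker] at h0
    refine ⟨?_, H.l_mem_hgen (by omega) hx⟩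
    rw [SetLike.mem_coe, LinearMap.mem_ker, i_l, h0, map_zero, H.i_eq_zero (by omega) hx]
    simp
  · rintro j hj x ⟨h0, hx⟩
    rw [SetLike.mem_coe, LinearMap.mem_ker] at h0
    refine ⟨?_, g_mem_hgen (Set.mem_univ j) hx⟩
    rw [SetLike.mem_coe, LinearMap.mem_ker, i_g, h0, map_zero]
  · rintro x ⟨h0, -⟩ hx
    exact H.inj x hx h0

lemma detects_i_step {K : ℤ} (hK : α ≤ K)
    (h : Detects α β z W₀ (hgen W₀ (Set.Ici (-K)) ∅)) :
    Detects α β z W₀ (hgen W₀ (Set.Ici (-(K + 1))) ∅) := by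
  intro U hUL hUG hU x hxU hx
  set A := hgen W₀ (Set.Ici (-K)) ∅ with hA
  let X : Module.End ℂ M.V := M.act (.i (-(K + 1)))
  have hle : hgen W₀ (Set.Ici (-(K + 1))) ∅ ≤ ⨆ n, ladder X A n := by
    refine hgen_le (fun x hx => Submodule.mem_iSup_of_mem 0 (subset_gen hx)) ?_
      fun m hm => hm.elim
    intro m hm x _ hx
    have : ⨆ n, ladder X A n ≤ (⨆ n, ladder X A n).comap (M.act (.i m)) := by
      refine iSup_le <| ladder_le fun n a ha => ?_
      rw [Submodule.mem_comap]
      rcases (Set.mem_Ici.1 hm).eq_or_lt with rfl | hm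
      · refine Submodule.mem_iSup_of_mem (n + 1) ?_
        rw [show M.act (.i (-(K + 1))) = X from rfl, ← Module.End.mul_apply, ← pow_succ']
        exact pow_mem_ladder (n + 1) ha
      · refine Submodule.mem_iSup_of_mem n ?_
        rw [apply_pow_comm (fun x => i_i M _ _ x)]
        exact pow_mem_ladder n (i_mem_hgen (Set.mem_Ici.2 (by omega)) ha)
    exact this hx
  obtain ⟨n, hn⟩ := (Submodule.mem_iSup_of_directed _ ladder_mono.directed_le).1 (hle hx)
  refine eq_zero_of_mem_ladder (X := X) (D := M.act (.l (z + K + 1))) (E := M.act (.i z))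
    (c := ((-(K + 1) : ℤ) : ℂ)) (A := A) ?_ (fun x => i_i M _ _ x) ?_ ?_ ?_ ?_ ?_ ?_ n x hxU hn
  · intro x
    rw [l_i, show (z : ℤ) + K + 1 + -(K + 1) = z by ring]
  · intro a ha
    exact H.l_eq_zero (by omega) (fun m hm => by rw [Set.mem_Ici] at hm; omega) ha
  · intro a ha
    exact i_mem_hgen (Set.mem_Ici.2 (by omega)) ha
  · exact_mod_cast (by omega : -(K + 1) ≠ 0)
  · exact fun a ha => H.inj_of_detects h ha
  · exact hUL _ (by omega)
  · exact h U hUL hUG hU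

lemma detects_g_step {K : ℤ} (hK : β ≤ K)
    (h : Detects α β z W₀ (hgen W₀ Set.univ (Set.Ici (-K)))) :
    Detects α β z W₀ (hgen W₀ Set.univ (Set.Ici (-(K + 1)))) := by
  intro U hUL hUG hU x hxU hx
  set B := hgen W₀ Set.univ (Set.Ici (-K)) with hB
  have hle : hgen W₀ Set.univ (Set.Ici (-(K + 1))) ≤ B ⊔ B.map (M.act (.g (-(K + 1)))) := by
    refine hgen_le (fun x hx => Submodule.mem_sup_left (subset_gen hx)) ?_ ?_
    · rintro m - x - hx
      obtain ⟨b, hb, _, ⟨b', hb', rfl⟩, rfl⟩ := Submodule.mem_sup.1 hx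
      rw [map_add, i_g]
      exact Submodule.add_mem_sup (i_mem_hgen (Set.mem_univ m) hb)
        (Submodule.mem_map_of_mem (i_mem_hgen (Set.mem_univ m) hb'))
    · rintro m hm x - hx
      obtain ⟨b, hb, _, ⟨b', hb', rfl⟩, rfl⟩ := Submodule.mem_sup.1 hx
      rw [map_add]
      rcases (Set.mem_Ici.1 hm).eq_or_lt with rfl | hm
      · refine add_mem (Submodule.mem_sup_right (Submodule.mem_map_of_mem hb))
          (Submodule.mem_sup_left ?_)
        have : M.act (.g (-(K + 1))) (M.act (.g (-(K + 1))) b') =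
            M.act (.i (-(K + 1) + -(K + 1))) b' := by
          have := g_g M (-(K + 1)) (-(K + 1)) b'
          linear_combination (norm := module) (1 / 2 : ℂ) • this
        rw [this]
        exact i_mem_hgen (Set.mem_univ _) hb'
      · have hm' : m ∈ Set.Ici (-K) := Set.mem_Ici.2 (by omega)
        refine add_mem (Submodule.mem_sup_left (g_mem_hgen hm' hb)) ?_
        rw [g_g]
        exact add_mem (neg_mem (Submodule.mem_sup_right
            (Submodule.mem_map_of_mem (g_mem_hgen hm' hb'))))
          (Submodule.smul_mem _ _ (Submodule.mem_sup_left (i_mem_hgen (Set.mem_univ _) hb')))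
  obtain ⟨b, hb, _, ⟨b', hb', rfl⟩, rfl⟩ := Submodule.mem_sup.1 (hle hx)
  have hlow : ∀ y ∈ B, M.act (.g (z + K + 1)) y = 0 := fun y hy =>
    H.g_eq_zero (by omega) (fun m hm => by rw [Set.mem_Ici] at hm; omega) hy
  have h1 := hUG (z + K + 1) (by omega) _ hxU
  rw [map_add, hlow b hb, g_g, hlow b' hb', show (z : ℤ) + K + 1 + -(K + 1) = z by ring,
    map_zero, neg_zero, zero_add, zero_add, Submodule.smul_mem_iff _ two_ne_zero] at h1
  obtain rfl : b' = 0 := H.inj_of_detects h hb'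
    (h U hUL hUG hU _ h1 (i_mem_hgen (Set.mem_univ _) hb'))
  rw [map_zero, add_zero] at hxU ⊢
  exact h U hUL hUG hU b hxU hb

lemma detects_i (n : ℕ) : Detects α β z W₀ (hgen W₀ (Set.Ici (-((α : ℤ) + n))) ∅) := by
  induction n with
  | zero =>
    intro U _ _ hU x hxU hx
    refine hU x hxU (hgen_le le_rfl (fun m hm x _ hx => ?_) (fun m hm => hm.elim) hx)
    exact H.stable (.i m) (i_mem_QS.2 (by simpa using hm)) x hx
  | succ n ih =>
    have := H.detects_i_step (by omega) ih
    rwa [show (α : ℤ) + n + 1 = α + (n + 1 : ℕ) by push_cast; ring] at this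

lemma detects_i_univ : Detects α β z W₀ (hgen W₀ Set.univ ∅) := by
  intro U hUL hUG hU x hxU hx
  obtain ⟨n, hn⟩ := mem_gen_iUnion (T := fun n : ℕ => heis (Set.Ici (-((α : ℤ) + n))) ∅)
    (fun a b hab => heis_mono (Set.Ici_subset_Ici.2 (by omega)) le_rfl) (by
      rintro (m | m | m) hm
      · exact hm.elim
      · exact ⟨m.natAbs, show -((α : ℤ) + m.natAbs) ≤ m by omega⟩
      · exact hm.elim) hx
  exact H.detects_i n U hUL hUG hU x hxU hn

lemma detects_g (n : ℕ) :
    Detects α β z W₀ (hgen W₀ Set.univ (Set.Ici (-((β : ℤ) + n)))) := by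
  induction n with
  | zero =>
    intro U hUL hUG hU x hxU hx
    refine H.detects_i_univ U hUL hUG hU x hxU (hgen_le (fun x hx => subset_gen hx)
      (fun m hm x _ hx => i_mem_hgen hm hx) (fun m hm x _ hx => ?_) hx)
    refine act_mem_gen_of _ (fun x hx => subset_gen (H.stable (.g m) ?_ x hx)) ?_ hx
    · exact g_mem_QS.2 (by simpa using hm)
    · rintro (k | k | k) hk hc
      · exact hk.elim
      · exact absurd rfl hc
      · exact hk.elim
  | succ n ih =>
    have := H.detects_g_step (by omega) ih
    rwa [show (β : ℤ) + n + 1 = β + (n + 1 : ℕ) by push_cast; ring] at this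

lemma detects_univ : Detects α β z W₀ (hgen W₀ Set.univ Set.univ) := by
  intro U hUL hUG hU x hxU hx
  obtain ⟨n, hn⟩ := mem_gen_iUnion
    (T := fun n : ℕ => heis Set.univ (Set.Ici (-((β : ℤ) + n))))
    (fun a b hab => heis_mono le_rfl (Set.Ici_subset_Ici.2 (by omega))) (by
      rintro (m | m | m) hm
      · exact hm.elim
      · exact ⟨0, Set.mem_univ m⟩
      · exact ⟨m.natAbs, show -((β : ℤ) + m.natAbs) ≤ m by omega⟩) hx
  exact H.detects_g n U hUL hUG hU x hxU hn

end Truncated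

end Heisenberg

/-! ### The action of the negative Virasoro part -/

section Virasoro

variable (M : GRep (Set.univ : Set SB)) (z : ℕ)

/-- The word `L_{-(j₁+1)} ⋯ L_{-(jₙ+1)}`. -/
noncomputable def lword (t : List ℕ) : Module.End ℂ M.V :=
  (t.map fun j => M.act (.l (-((j : ℤ) + 1)))).prod

lemma lword_cons (j : ℕ) (t : List ℕ) (x : M.V) :
    lword M (j :: t) x = M.act (.l (-((j : ℤ) + 1))) (lword M t x) := by
  simp [lword]

/-- Left multiplication by `I_{z+a+1}`. -/
def imulLeft (a : ℕ) (T : Module.End ℂ M.V) : Module.End ℂ M.V :=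
  M.act (.i ((z : ℤ) + a + 1)) ∘ₗ T

instance : LeftCommutative (imulLeft M z) where
  left_comm _ _ _ := LinearMap.ext fun _ => i_i M _ _ _

/-- The product of the `I_{z+a+1}` for `a ∈ k`. -/
noncomputable def imon (k : Multiset ℕ) : Module.End ℂ M.V :=
  k.foldr (imulLeft M z) 1

lemma imon_zero (x : M.V) : imon M z 0 x = x := rfl

lemma imon_cons (a : ℕ) (k : Multiset ℕ) (x : M.V) :
    imon M z (a ::ₘ k) x = M.act (.i ((z : ℤ) + a + 1)) (imon M z k x) := by
  simp [imon, imulLeft]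

lemma imon_mem {P : Submodule ℂ M.V} (hP : ∀ m, ∀ x ∈ P, M.act (.i m) x ∈ P)
    (k : Multiset ℕ) {x : M.V} (hx : x ∈ P) : imon M z k x ∈ P := by
  induction k using Multiset.induction_on with
  | empty => exact hx
  | cons a k ih => rw [imon_cons]; exact hP _ _ ih

lemma imon_l (k : Multiset ℕ) (n : ℤ) (x : M.V) :
    imon M z k (M.act (.l n) x) = M.act (.l n) (imon M z k x) -
      (k.map fun a : ℕ => ((z : ℂ) + a + 1) •
        M.act (.i ((z : ℤ) + a + 1 + n)) (imon M z (k.erase a) x)).sum := by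
  induction k using Multiset.induction_on with
  | empty => simp [imon_zero]
  | cons b k ih =>
    have hmap : (k.map fun a : ℕ => ((z : ℂ) + a + 1) •
          M.act (.i ((z : ℤ) + a + 1 + n)) (imon M z ((b ::ₘ k).erase a) x)) =
        k.map fun a : ℕ => M.act (.i ((z : ℤ) + b + 1)) (((z : ℂ) + a + 1) •
          M.act (.i ((z : ℤ) + a + 1 + n)) (imon M z (k.erase a) x)) := by
      refine Multiset.map_congr rfl fun a ha => ?_
      rw [Multiset.erase_cons_tail_of_mem ha, imon_cons, map_smul, i_i]
    rw [imon_cons, ih, map_sub, i_l, imon_cons, Multiset.map_cons, Multiset.sum_cons,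
      Multiset.erase_cons_head, hmap, map_multiset_sum, Multiset.map_map, sub_sub]
    push_cast
    rfl

variable {M z} {F : Submodule ℂ M.V} (hi : ∀ m, ∀ x ∈ F, M.act (.i m) x ∈ F)
  (hz : ∀ m : ℤ, (z : ℤ) < m → ∀ x ∈ F, M.act (.i m) x = 0)
include hi hz

lemma imon_lword_of_lt (t : List ℕ) : ∀ k : Multiset ℕ, t.length < k.card →
    ∀ u ∈ F, imon M z k (lword M t u) = 0 := by
  induction t with
  | nil =>
    intro k hk u hu
    obtain ⟨a, ha⟩ := Multiset.card_pos_iff_exists_mem.1 hk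
    obtain ⟨k, rfl⟩ := Multiset.exists_cons_of_mem ha
    rw [imon_cons]
    exact hz _ (by omega) _ (imon_mem M z hi k hu)
  | cons j t ih =>
    intro k hk u hu
    rw [List.length_cons] at hk
    rw [lword_cons, imon_l, ih k (by omega) u hu, map_zero, zero_sub, neg_eq_zero]
    refine Multiset.sum_eq_zero fun y hy => ?_
    obtain ⟨a, ha, rfl⟩ := Multiset.mem_map.1 hy
    rw [ih _ (by rw [Multiset.card_erase_of_mem ha, Nat.pred_eq_sub_one]; omega) u hu, map_zero,
      smul_zero]

omit hi hz in
/-- The coefficient relating `imon t ∘ lword t` to a power of `I_z`. -/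
noncomputable def lcoef (z : ℕ) : List ℕ → ℂ
  | [] => 1
  | j :: t => -((j :: t).count j * ((z : ℂ) + j + 1)) * lcoef z t

omit hi hz in
lemma lcoef_ne_zero (z : ℕ) (t : List ℕ) : lcoef z t ≠ 0 := by
  induction t with
  | nil => exact one_ne_zero
  | cons j t ih =>
    refine mul_ne_zero (neg_ne_zero.2 (mul_ne_zero ?_
      (by exact_mod_cast Nat.succ_ne_zero (z + j)))) ih
    rw [List.count_cons_self, Nat.cast_add_one]
    exact Nat.cast_add_one_ne_zero _

omit hi hz in
lemma sum_map_ite_eq (k : Multiset ℕ) (j : ℕ) (y : M.V) :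
    (k.map fun a => if a = j then y else 0).sum = (k.count j : ℂ) • y := by
  induction k using Multiset.induction_on with
  | empty => simp
  | cons a k ih =>
    rw [Multiset.map_cons, Multiset.sum_cons, ih, Multiset.count_cons]
    by_cases h : a = j
    · subst h
      simp only [if_true]
      push_cast
      module
    · simp [h, Ne.symm h]

lemma imon_lword (t : List ℕ) : ∀ k : Multiset ℕ, k.card = t.length → t.sum ≤ k.sum →
    ∀ u ∈ F, imon M z k (lword M t u) =
      if k = t then lcoef z t • ((M.act (.i z) : Module.End ℂ M.V) ^ t.length) u else 0 := by
  induction t with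
  | nil =>
    intro k hk _ u _
    obtain rfl := Multiset.card_eq_zero.1 hk
    simp [imon_zero, lword, lcoef]
  | cons j t ih =>
    intro k hk hsum u hu
    rw [List.length_cons] at hk
    rw [List.sum_cons] at hsum
    have hterm : ∀ a ∈ k, ((z : ℂ) + a + 1) •
        M.act (.i ((z : ℤ) + a + 1 + -((j : ℤ) + 1))) (imon M z (k.erase a) (lword M t u)) =
        if a = j then ((z : ℂ) + j + 1) • (if k.erase j = t then
          lcoef z t • ((M.act (.i z) : Module.End ℂ M.V) ^ (t.length + 1)) u else 0) else 0 := by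
      intro a ha
      have hcard : (k.erase a).card = t.length := by
        rw [Multiset.card_erase_of_mem ha, hk, Nat.pred_succ]
      have hs : a + (k.erase a).sum = k.sum := Multiset.sum_erase ha
      split_ifs with haj hkt
      · subst haj
        rw [ih _ hcard (by omega) u hu, if_pos hkt, map_smul, pow_succ', Module.End.mul_apply,
          show (z : ℤ) + a + 1 + -((a : ℤ) + 1) = z by ring]
      · subst haj
        rw [ih _ hcard (by omega) u hu, if_neg hkt, map_zero]
      · rcases lt_or_gt_of_ne haj with haj | haj
        · rw [ih _ hcard (by omega) u hu, if_neg, map_zero, smul_zero]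
          intro h
          have := congrArg Multiset.sum h
          rw [Multiset.sum_coe] at this
          omega
        · rw [show (z : ℤ) + a + 1 + -((j : ℤ) + 1) = z + (a - j - 1 : ℕ) + 1 by omega,
            ← imon_cons, imon_lword_of_lt hi hz t _ (by rw [Multiset.card_cons]; omega) u hu,
            smul_zero]
    rw [lword_cons, imon_l, imon_lword_of_lt hi hz t k (by omega) u hu, map_zero, zero_sub,
      Multiset.map_congr rfl hterm]
    rw [sum_map_ite_eq]
    by_cases hk' : k = ↑(j :: t)
    · subst hk'
      rw [if_pos rfl, Multiset.coe_erase, List.erase_cons_head, if_pos rfl, Multiset.coe_count,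
        List.length_cons, lcoef]
      module
    · rw [if_neg hk']
      by_cases hjk : j ∈ k
      · rw [if_neg, smul_zero, smul_zero, neg_zero]
        intro h
        exact hk' (by rw [← Multiset.cons_erase hjk, h, Multiset.cons_coe])
      · rw [Multiset.count_eq_zero_of_notMem hjk, Nat.cast_zero, zero_smul, neg_zero]

omit hi hz in
/-- The span of the vectors `lword t u` with `u ∈ F` and `t` of length less than `d`. -/
noncomputable def lspan (F : Submodule ℂ M.V) (d : ℕ) : Submodule ℂ M.V :=
  ⨆ t : {t : List ℕ // t.length < d}, F.map (lword M t.1)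

omit hi hz in
lemma lword_mem_lspan {d : ℕ} {t : List ℕ} (ht : t.length < d) {u : M.V} (hu : u ∈ F) :
    lword M t u ∈ lspan F d :=
  Submodule.mem_iSup_of_mem ⟨t, ht⟩ (Submodule.mem_map_of_mem hu)

omit hi hz in
lemma lspan_le {d : ℕ} {P : Submodule ℂ M.V}
    (h : ∀ t : List ℕ, t.length < d → ∀ u ∈ F, lword M t u ∈ P) : lspan F d ≤ P := by
  refine iSup_le ?_
  rintro ⟨t, ht⟩ _ ⟨u, hu, rfl⟩
  exact h t ht u hu

omit hi hz in
lemma lspan_mono : Monotone (lspan F) := fun _ _ h =>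
  lspan_le fun _ ht _ hu => lword_mem_lspan (by omega) hu

omit hi hz in
lemma l_mem_lspan (j : ℕ) {d : ℕ} {x : M.V} (hx : x ∈ lspan F d) :
    M.act (.l (-((j : ℤ) + 1))) x ∈ lspan F (d + 1) := by
  suffices h : lspan F d ≤ (lspan F (d + 1)).comap (M.act (.l (-((j : ℤ) + 1)))) from h hx
  refine lspan_le fun t ht u hu => ?_
  rw [Submodule.mem_comap, ← lword_cons]
  exact lword_mem_lspan (by simpa using ht) hu

omit hi hz in
lemma lword_sub_mem_lspan {t t' : List ℕ} (h : t.Perm t') {u : M.V} (hu : u ∈ F) :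
    lword M t u - lword M t' u ∈ lspan F t.length := by
  induction h with
  | nil => simp
  | cons j _ ih =>
    rw [lword_cons, lword_cons, ← map_sub]
    exact l_mem_lspan j ih
  | swap i j t =>
    rw [lword_cons, lword_cons, lword_cons, lword_cons, l_l, add_sub_cancel_left,
      show -((j : ℤ) + 1) + -((i : ℤ) + 1) = -(((j + i + 1 : ℕ) : ℤ) + 1) by push_cast; ring,
      ← lword_cons]
    exact Submodule.smul_mem _ _ (lword_mem_lspan (by simp) hu)
  | trans h₁ _ ih₁ ih₂ =>
    rw [← sub_add_sub_cancel]
    exact add_mem ih₁ (h₁.length_eq ▸ ih₂)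

omit hi hz in
lemma exists_leading (d : ℕ) {x : M.V} (hx : x ∈ lspan F (d + 1)) :
    ∃ f : Multiset ℕ →₀ M.V, (∀ s ∈ f.support, s.card = d) ∧ (∀ s, f s ∈ F) ∧
      x - f.sum (fun s u => lword M s.toList u) ∈ lspan F d := by
  classical
  let Φ : (Multiset ℕ →₀ M.V) →ₗ[ℂ] M.V := Finsupp.lsum ℂ fun s => lword M s.toList
  let R : Submodule ℂ (Multiset ℕ →₀ M.V) :=
    Finsupp.supported M.V ℂ {s | s.card = d} ⊓ ⨅ s, F.comap (Finsupp.lapply s)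
  suffices h : lspan F (d + 1) ≤ lspan F d ⊔ R.map Φ by
    obtain ⟨c, hc, _, ⟨f, hf, rfl⟩, rfl⟩ := Submodule.mem_sup.1 (h hx)
    refine ⟨f, fun s hs => (Finsupp.mem_supported ℂ f).1 hf.1 hs,
      fun s => (Submodule.mem_iInf _).1 hf.2 s, ?_⟩
    change c + Φ f - Φ f ∈ _
    rwa [add_sub_cancel_right]
  refine lspan_le fun t ht u hu => ?_
  rcases (Nat.lt_succ_iff.1 ht).lt_or_eq with ht | rfl
  · exact Submodule.mem_sup_left (lword_mem_lspan ht hu)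
  · rw [← sub_add_cancel (lword M t u) (lword M (t : Multiset ℕ).toList u)]
    refine add_mem (Submodule.mem_sup_left (lword_sub_mem_lspan
      (Multiset.coe_eq_coe.1 (Multiset.coe_toList _).symm) hu)) (Submodule.mem_sup_right
        ⟨Finsupp.single t u, ⟨Finsupp.single_mem_supported ℂ _ (Multiset.coe_card t),
          (Submodule.mem_iInf _).2 fun s => ?_⟩, by simp [Φ]⟩)
    rw [Submodule.mem_comap, Finsupp.lapply_apply, Finsupp.single_apply]
    split_ifs
    · exact hu
    · exact zero_mem _

lemma eq_zero_of_mem_lspan (hinj : ∀ x ∈ F, M.act (.i z) x = 0 → x = 0)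
    {U : Submodule ℂ M.V} (hUi : ∀ m, ∀ x ∈ U, M.act (.i m) x ∈ U)
    (hU : ∀ x ∈ U, x ∈ F → x = 0) (d : ℕ) : ∀ x ∈ U, x ∈ lspan F d → x = 0 := by
  have hpow : ∀ n, ∀ u ∈ F, ((M.act (.i z) : Module.End ℂ M.V) ^ n) u ∈ F ∧
      (((M.act (.i z) : Module.End ℂ M.V) ^ n) u = 0 → u = 0) := by
    intro n
    induction n with
    | zero => exact fun u hu => ⟨hu, id⟩
    | succ n ih =>
      intro u hu
      rw [pow_succ, Module.End.mul_apply]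
      exact ⟨(ih _ (hi _ u hu)).1, fun h => hinj u hu ((ih _ (hi _ u hu)).2 h)⟩
  induction d with
  | zero =>
    intro x _ hx
    simpa using lspan_le (P := ⊥) (fun t ht => absurd ht (Nat.not_lt_zero _)) hx
  | succ d ih =>
    intro x hxU hx
    obtain ⟨f, hcard, hfF, hf⟩ := exists_leading d hx
    by_cases hf0 : f = 0
    · subst hf0
      exact ih x hxU (by simpa using hf)
    exfalso
    obtain ⟨s, hs, hmax⟩ := f.support.exists_max_image Multiset.sum
      (Finsupp.support_nonempty_iff.2 hf0)
    have h1 : imon M z s (x - f.sum fun s u => lword M s.toList u) = 0 := by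
      suffices h : lspan F d ≤ LinearMap.ker (imon M z s) from h hf
      exact lspan_le fun t ht u hu =>
        imon_lword_of_lt hi hz t s (by rw [hcard s hs]; exact ht) u hu
    have h2 : imon M z s (f.sum fun s u => lword M s.toList u) =
        lcoef z s.toList • ((M.act (.i z) : Module.End ℂ M.V) ^ d) (f s) := by
      rw [Finsupp.sum, map_sum, Finset.sum_eq_single_of_mem s hs]
      · rw [imon_lword hi hz _ _ (by simp) (by simp) _ (hfF s), if_pos (by simp),
          Multiset.length_toList, hcard s hs]
      · intro s' hs' hne
        rw [imon_lword hi hz _ _ (by simp [hcard s hs, hcard s' hs'])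
          (by simpa using hmax s' hs') _ (hfF s'), if_neg (by simpa using hne.symm)]
    rw [map_sub, h2, sub_eq_zero] at h1
    have h3 := imon_mem M z hUi s hxU
    rw [h1, Submodule.smul_mem_iff _ (lcoef_ne_zero z _)] at h3
    exact Finsupp.mem_support_iff.1 hs
      ((hpow d _ (hfF s)).2 (hU _ h3 (hpow d _ (hfF s)).1))

omit hi hz in
lemma act_mem_iSup_lspan (hF : ∀ a : SB, (∀ m < 0, a ≠ .l m) → ∀ x ∈ F, M.act a x ∈ F)
    (a : SB) {x : M.V} (hx : x ∈ ⨆ d, lspan F d) : M.act a x ∈ ⨆ d, lspan F d := by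
  have hl : ∀ j : ℕ, ∀ x ∈ ⨆ d, lspan F d,
      M.act (.l (-((j : ℤ) + 1))) x ∈ ⨆ d, lspan F d := by
    intro j x hx
    obtain ⟨d, hd⟩ := (Submodule.mem_iSup_of_directed _ lspan_mono.directed_le).1 hx
    exact Submodule.mem_iSup_of_mem (d + 1) (l_mem_lspan j hd)
  have hword : ∀ t : List ℕ, ∀ u ∈ F, lword M t u ∈ ⨆ d, lspan F d := fun t u hu =>
    Submodule.mem_iSup_of_mem (t.length + 1) (lword_mem_lspan (Nat.lt_succ_self _) hu)
  have key : ∀ (t : List ℕ) (a : SB), ∀ u ∈ F, M.act a (lword M t u) ∈ ⨆ d, lspan F d := by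
    intro t
    induction t with
    | nil =>
      intro a u hu
      by_cases ha : ∀ m < 0, a ≠ .l m
      · exact hword [] _ (hF a ha u hu)
      · push Not at ha
        obtain ⟨m, hm, rfl⟩ := ha
        obtain ⟨j, rfl⟩ : ∃ j : ℕ, m = -((j : ℤ) + 1) := ⟨(-m - 1).toNat, by omega⟩
        exact hl j _ (hword [] u hu)
    | cons j t ih =>
      intro a u hu
      rw [lword_cons, act_act M (Set.mem_univ a) (Set.mem_univ (.l (-((j : ℤ) + 1))))]
      exact add_mem (Submodule.smul_mem _ _ (hl j _ (ih a u hu)))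
        (Submodule.smul_mem _ _ (ih _ u hu))
  suffices h : ⨆ d, lspan F d ≤ (⨆ d, lspan F d).comap (M.act a) from h hx
  exact iSup_le fun d => lspan_le fun t _ u hu => key t a u hu

end Virasoro

/-! ### Simplicity -/

lemma Truncated.eq_bot {M : GRep (Set.univ : Set SB)} {α β z : ℕ} {W₀ : Submodule ℂ M.V}
    (H : Truncated M α β z W₀) (htop : gen M.act Set.univ (W₀ : Set M.V) = ⊤)
    {U : Submodule ℂ M.V} (hU : ∀ a, ∀ x ∈ U, M.act a x ∈ U)
    (hUW : ∀ x ∈ U, x ∈ W₀ → x = 0) : U = ⊥ := by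
  set F := hgen W₀ Set.univ Set.univ
  have hF : ∀ a : SB, (∀ m < 0, a ≠ .l m) → ∀ x ∈ F, M.act a x ∈ F := by
    rintro (m | m | m) ha x hx
    · exact H.l_mem_hgen (not_lt.1 fun hm => ha m hm rfl) hx
    · exact i_mem_hgen (Set.mem_univ m) hx
    · exact g_mem_hgen (Set.mem_univ m) hx
  have hmem : ∀ x : M.V, x ∈ ⨆ d, lspan F d := by
    intro x
    have hx : x ∈ gen M.act Set.univ (W₀ : Set M.V) := htop ▸ Submodule.mem_top
    refine gen_le (fun x hx => ?_) (fun a _ x _ hx => act_mem_iSup_lspan hF a hx) hx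
    exact Submodule.mem_iSup_of_mem 1
      (lword_mem_lspan (t := []) Nat.one_pos (subset_gen hx))
  rw [eq_bot_iff]
  intro x hx
  obtain ⟨d, hd⟩ := (Submodule.mem_iSup_of_directed _ lspan_mono.directed_le).1 (hmem x)
  exact eq_zero_of_mem_lspan (fun m x hx => i_mem_hgen (Set.mem_univ m) hx)
    (fun m hm x hx => H.i_eq_zero hm hx) (fun x hx => H.inj_of_detects H.detects_univ hx)
    (fun m => hU _) (H.detects_univ U (fun j _ => hU _) (fun j _ => hU _) hUW) d x hx hd

/-- An induced module is generated by the image of the module it is induced from. -/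
lemma gen_range_eq_top {Q : Set SB} {ρ : GRep Q} {M : GRep (Set.univ : Set SB)}
    {ι : ρ.V →ₗ[ℂ] M.V} (hind : IsInduced Q ρ M ι) :
    gen M.act Set.univ (LinearMap.range ι : Set M.V) = ⊤ := by
  set R := gen M.act Set.univ (LinearMap.range ι : Set M.V) with hR
  have hgr : IsGraded M.grade R := by
    refine isGraded_gen ?_ fun a ha p => ⟨_, fun x hx => M.act_grade a ha p x hx⟩
    rintro _ ⟨v, rfl⟩
    obtain ⟨v0, h0, v1, h1, rfl⟩ := ρ.grade_sup v
    rw [map_add]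
    exact Submodule.add_mem_sup ⟨subset_gen ⟨v0, rfl⟩, hind.1.2 0 v0 h0⟩
      ⟨subset_gen ⟨v1, rfl⟩, hind.1.2 1 v1 h1⟩
  have hstable : ∀ a, ∀ x ∈ R, M.act a x ∈ R := fun a x hx => act_mem_gen (Set.mem_univ a) hx
  let N := quotRep M.act M.grade M.grade_sup M.grade_inf
    (fun a p v hv => M.act_grade a (Set.mem_univ a) p v hv) R hstable hgr (fun a b x => by
      rw [act_act M (Set.mem_univ a) (Set.mem_univ b), add_sub_cancel_left, sub_self]
      exact zero_mem _)
  have hzero : SEquivMap Q ρ N 0 :=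
    ⟨fun a _ v => (map_zero (N.act a)).symm, fun p v _ => zero_mem _⟩
  have hmkQ : R.mkQ = 0 := (hind.2 N 0 hzero).unique
    ⟨⟨fun _ _ _ => rfl, fun _ v hv => ⟨v, hv, rfl⟩⟩,
      LinearMap.ext fun v => (Submodule.Quotient.mk_eq_zero R).2 (subset_gen ⟨v, rfl⟩)⟩
    ⟨⟨fun a _ v => (map_zero (N.act a)).symm, fun p v _ => zero_mem _⟩, rfl⟩
  rw [← Submodule.ker_mkQ R, hmkQ, LinearMap.ker_zero]

lemma induced_injective {α β : ℕ} (h : 2 * β ≤ α) {ρ : GRep (QS α β)}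
    {M : GRep (Set.univ : Set SB)} {ι : ρ.V →ₗ[ℂ] M.V} (hind : IsInduced (QS α β) ρ M ι) :
    Function.Injective ι := by
  obtain ⟨N, f, hf, hinj⟩ := exists_embedding h ρ
  obtain ⟨F, ⟨-, rfl⟩, -⟩ := hind.2 N f hf
  exact Function.Injective.of_comp hinj

/-- The preimage of a graded submodule under an injective even equivariant map. -/
lemma isSub_comap {Q Q' : Set SB} {ρ : GRep Q} {M : GRep Q'} {ι : ρ.V →ₗ[ℂ] M.V}
    (hQ : Q ⊆ Q') (hι : SEquivMap Q ρ M ι) {U : Submodule ℂ M.V} (hU : IsSub M U) :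
    IsSub ρ (U.comap ι) := by
  refine ⟨fun a ha v hv => ?_, fun v hv => ?_⟩
  · rw [Submodule.mem_comap, hι.1 a ha]
    exact hU.1 a (hQ ha) _ hv
  · obtain ⟨v0, h0, v1, h1, rfl⟩ := ρ.grade_sup v
    obtain ⟨u0, hu0, hg0, u1, hu1, hg1, hu⟩ := hU.2 _ hv
    rw [map_add] at hu
    have h : ι v0 - u0 ∈ M.grade 0 ⊓ M.grade 1 := by
      refine ⟨sub_mem (hι.2 0 v0 h0) hg0, ?_⟩
      rw [show ι v0 - u0 = u1 - ι v1 by linear_combination (norm := module) hu]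
      exact sub_mem hg1 (hι.2 1 v1 h1)
    rw [M.grade_inf, Submodule.mem_bot, sub_eq_zero] at h
    rw [h, add_right_inj] at hu
    exact ⟨v0, by rwa [Submodule.mem_comap, h], h0, v1, by rwa [Submodule.mem_comap, hu], h1, rfl⟩

end SHVInd

/-- If `V` is a simple 𝔖_{α,β}-module (α ≥ 2β) on which some `I_z`
(z ≥ 0) acts injectively and `L_i V = 0` for `i > z+α`, `G_j V = 0` for `j > z+β`,
`I_k V = 0` for `k > z`, then the induced module `Ind(V) = U(𝔖) ⊗_{U(𝔖_{α,β})} V`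
is a simple 𝔖-module. -/
theorem induced_module_simple (α β : ℕ) (hαβ : 2 * β ≤ α)
    (ρV : GRep (QS α β)) (hsimple : IsSimple ρV) (z : ℕ)
    (hinj : Function.Injective (ρV.act (.i (z : ℤ))))
    (hL : ∀ i : ℤ, (z : ℤ) + (α : ℤ) < i → ρV.act (.l i) = 0)
    (hG : ∀ j : ℤ, (z : ℤ) + (β : ℤ) < j → ρV.act (.g j) = 0)
    (hI : ∀ k : ℤ, (z : ℤ) < k → ρV.act (.i k) = 0)
    (M : GRep (Set.univ : Set SB)) (ι : ρV.V →ₗ[ℂ] M.V)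
    (hind : IsInduced (QS α β) ρV M ι) :
    IsSimple M := by
  have hιinj := SHVInd.induced_injective hαβ hind
  have H : SHVInd.Truncated M α β z (LinearMap.range ι) := by
    refine ⟨?_, ?_, ?_, ?_, ?_⟩
    · rintro a ha _ ⟨v, rfl⟩
      exact ⟨ρV.act a v, hind.1.1 a ha v⟩
    · rintro _ ⟨v, rfl⟩ hv
      rw [← hind.1.1 _ (SHVInd.i_mem_QS.2 (by omega)), map_eq_zero_iff ι hιinj,
        map_eq_zero_iff _ hinj] at hv
      rw [hv, map_zero]
    · rintro j hj _ ⟨v, rfl⟩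
      rw [← hind.1.1 _ (SHVInd.l_mem_QS.2 (by omega)), hL j hj, LinearMap.zero_apply, map_zero]
    · rintro j hj _ ⟨v, rfl⟩
      rw [← hind.1.1 _ (SHVInd.g_mem_QS.2 (by omega)), hG j hj, LinearMap.zero_apply, map_zero]
    · rintro j hj _ ⟨v, rfl⟩
      rw [← hind.1.1 _ (SHVInd.i_mem_QS.2 (by omega)), hI j hj, LinearMap.zero_apply, map_zero]
  have htop := SHVInd.gen_range_eq_top hind
  obtain ⟨⟨v, hv⟩, hsub⟩ := hsimple
  refine ⟨⟨ι v, (map_ne_zero_iff ι hιinj).2 hv⟩, fun U hU => ?_⟩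
  have hstable : ∀ a, ∀ x ∈ U, M.act a x ∈ U := fun a x hx => hU.1 a (Set.mem_univ a) x hx
  rcases hsub _ (SHVInd.isSub_comap (Set.subset_univ _) hind.1 hU) with h | h
  · refine Or.inl (H.eq_bot htop hstable ?_)
    rintro _ hx ⟨w, rfl⟩
    have hw : w ∈ U.comap ι := hx
    rw [h, Submodule.mem_bot] at hw
    rw [hw, map_zero]
  · refine Or.inr (top_le_iff.1 (htop ▸ SHVInd.gen_le ?_ fun a _ x _ hx => hstable a x hx))
    rintro _ ⟨w, rfl⟩
    have hw : w ∈ U.comap ι := h ▸ Submodule.mem_top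
    exact hw
end

section
/- Let α, β ∈ ℤ≥0 with α ≥ 2β and let V be a simple 𝔖_{α,β}-module for which there exists z ∈ ℤ≥0 with I_z acting injectively on V and L_i V = 0 (i > z+α), G_j V = 0 (j > z+β), I_k V = 0 (k > z). Then the induced 𝔖-module Ind(V) = U(𝔖) ⊗_{U(𝔖_{α,β})} V is a restricted 𝔖-module. -/
/-- The ℤ-degree of a basis element of 𝔖. -/
def SB.deg : SB → ℤ
  | .l m => m
  | .i m => m
  | .g m => m

theorem SB.deg_of_sb_ne_zero {a b c : SB} (h : sb a b c ≠ 0) : c.deg = a.deg + b.deg := by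
  contrapose! h
  rcases a with m | m | m <;> rcases b with n | n | n <;>
    simp only [sb, Finsupp.smul_apply, Finsupp.coe_zero, Pi.zero_apply, smul_eq_mul] <;>
    (rw [Finsupp.single_eq_of_ne (by rintro rfl; exact h rfl), mul_zero])

theorem GRep.eq_zero_of_add_eq_zero {Q : Set SB} (M : GRep Q) {p q : ZMod 2} (hpq : p ≠ q)
    {v w : M.V} (hv : v ∈ M.grade p) (hw : w ∈ M.grade q) (h : v + w = 0) :
    v = 0 ∧ w = 0 := by
  have hvw : v = -w := eq_neg_of_add_eq_zero_left h
  have hvq : v ∈ M.grade q := hvw ▸ (M.grade q).neg_mem hw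
  have hv0 : v = 0 := by
    rw [← Submodule.mem_bot ℂ, ← M.grade_inf]
    have key : ∀ p q : ZMod 2, p ≠ q → p = 0 ∧ q = 1 ∨ p = 1 ∧ q = 0 := by decide
    rcases key p q hpq with ⟨rfl, rfl⟩ | ⟨rfl, rfl⟩
    exacts [⟨hv, hvq⟩, ⟨hvq, hv⟩]
  exact ⟨hv0, by simpa [hv0] using h⟩

/-- The vectors annihilated by all basis elements of sufficiently large degree. -/
def GRep.restrictedPart (M : GRep (Set.univ : Set SB)) : Submodule ℂ M.V where
  carrier := {w | ∃ k : ℕ, ∀ a : SB, (k : ℤ) < a.deg → M.act a w = 0}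
  zero_mem' := ⟨0, fun a _ => map_zero _⟩
  add_mem' := by
    rintro v w ⟨k, hk⟩ ⟨l, hl⟩
    refine ⟨k + l, fun a ha => ?_⟩
    rw [map_add, hk a (by omega), hl a (by omega), add_zero]
  smul_mem' := by
    rintro c w ⟨k, hk⟩
    exact ⟨k, fun a ha => by rw [map_smul, hk a ha, smul_zero]⟩

theorem GRep.act_mem_restrictedPart (M : GRep (Set.univ : Set SB)) (b : SB) {w : M.V}
    (hw : w ∈ M.restrictedPart) : M.act b w ∈ M.restrictedPart := by
  obtain ⟨k, hk⟩ := hw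
  refine ⟨k + b.deg.natAbs, fun a ha => ?_⟩
  have h := M.act_br a trivial b trivial w
  rw [hk a (by omega), map_zero, smul_zero, sub_zero] at h
  rw [h]
  refine Finset.sum_eq_zero fun c hc => ?_
  have hdeg := SB.deg_of_sb_ne_zero (Finsupp.mem_support_iff.mp hc)
  simp only [hk c (by omega), smul_zero]

theorem GRep.exists_homogeneous_of_mem_restrictedPart (M : GRep (Set.univ : Set SB)) {w : M.V}
    (hw : w ∈ M.restrictedPart) :
    ∃ w0 ∈ M.restrictedPart, ∃ w1 ∈ M.restrictedPart,
      w0 ∈ M.grade 0 ∧ w1 ∈ M.grade 1 ∧ w = w0 + w1 := by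
  obtain ⟨k, hk⟩ := hw
  obtain ⟨w0, h0, w1, h1, rfl⟩ := M.grade_sup w
  have key (a : SB) (ha : (k : ℤ) < a.deg) : M.act a w0 = 0 ∧ M.act a w1 = 0 := by
    refine M.eq_zero_of_add_eq_zero (p := par a + 0) (q := par a + 1) (by simp)
      (M.act_grade a trivial 0 w0 h0) (M.act_grade a trivial 1 w1 h1) ?_
    rw [← map_add, hk a ha]
  exact ⟨w0, ⟨k, fun a ha => (key a ha).1⟩, w1, ⟨k, fun a ha => (key a ha).2⟩, h0, h1, rfl⟩

/-- The restricted part of an 𝔖-module, as an 𝔖-module. -/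
def GRep.restricted (M : GRep (Set.univ : Set SB)) : GRep (Set.univ : Set SB) where
  V := M.restrictedPart
  act a := (M.act a).restrict fun _ => M.act_mem_restrictedPart a
  grade p := (M.grade p).comap M.restrictedPart.subtype
  grade_sup v := by
    obtain ⟨w0, hw0, w1, hw1, h0, h1, h⟩ := M.exists_homogeneous_of_mem_restrictedPart v.2
    exact ⟨⟨w0, hw0⟩, h0, ⟨w1, hw1⟩, h1, Subtype.ext h⟩
  grade_inf := by
    rw [← Submodule.comap_inf, M.grade_inf]
    exact Submodule.ker_subtype _
  act_grade a ha p v hv := M.act_grade a ha p v hv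
  act_br a ha b hb v := by
    apply Subtype.ext
    simpa [Finsupp.sum] using M.act_br a ha b hb v

theorem IsInduced.eq_top_of_forall_mem_restrictedPart {Q : Set SB} {ρ : GRep Q}
    {M : GRep (Set.univ : Set SB)} {ι : ρ.V →ₗ[ℂ] M.V} (hind : IsInduced Q ρ M ι)
    (hι : ∀ v, ι v ∈ M.restrictedPart) : M.restrictedPart = ⊤ := by
  obtain ⟨⟨hact, hgrade⟩, huniv⟩ := hind
  obtain ⟨F, ⟨⟨hFact, hFgrade⟩, hFι⟩, -⟩ := huniv M.restricted (ι.codRestrict _ hι)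
    ⟨fun a ha v => Subtype.ext (hact a ha v), hgrade⟩
  have hcomp : M.restrictedPart.subtype ∘ₗ F = LinearMap.id := by
    refine (huniv M ι ⟨hact, hgrade⟩).unique
      ⟨⟨fun a ha v => congrArg Subtype.val (hFact a ha v), hFgrade⟩, ?_⟩
      ⟨⟨fun _ _ _ => rfl, fun _ _ h => h⟩, rfl⟩
    ext v
    exact congrArg Subtype.val (LinearMap.congr_fun hFι v)
  refine Submodule.eq_top_iff'.mpr fun w => ?_
  rw [show w = (F w).val from (LinearMap.congr_fun hcomp w).symm]
  exact (F w).2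

/-- Under the hypotheses of Theorem 4.3, the induced module
`Ind(V) = U(𝔖) ⊗_{U(𝔖_{α,β})} V` is a restricted 𝔖-module. -/
theorem induced_module_restricted (α β : ℕ) (hαβ : 2 * β ≤ α)
    (ρV : GRep (QS α β)) (hsimple : IsSimple ρV) (z : ℕ)
    (hinj : Function.Injective (ρV.act (.i (z : ℤ))))
    (hL : ∀ i : ℤ, (z : ℤ) + (α : ℤ) < i → ρV.act (.l i) = 0)
    (hG : ∀ j : ℤ, (z : ℤ) + (β : ℤ) < j → ρV.act (.g j) = 0)
    (hI : ∀ k : ℤ, (z : ℤ) < k → ρV.act (.i k) = 0)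
    (M : GRep (Set.univ : Set SB)) (ι : ρV.V →ₗ[ℂ] M.V)
    (hind : IsInduced (QS α β) ρV M ι) :
    IsRestricted M := by
  have hι (v : ρV.V) : ι v ∈ M.restrictedPart := by
    refine ⟨z + α + β, fun a ha => ?_⟩
    push_cast at ha
    have hzero : ρV.act a = 0 := by
      rcases a with m | m | m <;> simp only [SB.deg] at ha
      exacts [hL m (by omega), hI m (by omega), hG m (by omega)]
    have hmem : a ∈ QS α β := by
      rcases a with m | m | m <;> simp only [SB.deg] at ha
      exacts [show 0 ≤ m by omega, show -(α : ℤ) ≤ m by omega, show -(β : ℤ) ≤ m by omega]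
    rw [← hind.1.1 a hmem v, hzero, LinearMap.zero_apply, map_zero]
  intro w
  obtain ⟨k, hk⟩ : w ∈ M.restrictedPart :=
    hind.eq_top_of_forall_mem_restrictedPart hι ▸ Submodule.mem_top
  exact ⟨k, fun i hi => ⟨hk (.l i) hi, hk (.g i) hi, hk (.i i) hi⟩⟩
end
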